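/- arXiv:1309.2167 — 2 statements merged into one kernel-verified Lean document; each statement's English description precedes it below -/
import Mathlib

section
/- Let k ≥ 0 be even and let d_k(t) = (1/π)·lim_{y→0⁺} Im g_k(t + iy) for t ∈ I_k ∖ {0}. Then d_k is Lebesgue integrable on I_k and for every z ∈ ℂ₊ one has g_k(z) = ∫_{−Γ(x_k)}^{−Γ(x_{k+1})} d_k(t)/(t − z) dt − k. -/
open Complex Filter

/-- The holomorphic branch `L` of `log Γ` on `ℂ ∖ (−∞,0]`:
`L(z) = −γz − Log z − ∑_{k=1}^∞ (Log(1 + z/k) − z/k)`. -/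
noncomputable def logGamma (z : ℂ) : ℂ :=
  -(Real.eulerMascheroniConstant : ℂ) * z - Complex.log z -
    ∑' k : ℕ, (Complex.log (1 + z / (k + 1)) - z / (k + 1))

open scoped Topology ComplexConjugate

/-- The partial sums of the series defining `logGamma`. -/
noncomputable def logGammaPartial (n : ℕ) (z : ℂ) : ℂ :=
  -(Real.eulerMascheroniConstant : ℂ) * z - Complex.log z -
    ∑ j ∈ Finset.range n, (Complex.log (1 + z / (j + 1)) - z / (j + 1))

lemma norm_log_one_add_div_sub_le {z : ℂ} {j : ℕ} (h : 2 * ‖z‖ ≤ (j : ℝ) + 1) :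
    ‖Complex.log (1 + z / (j + 1)) - z / (j + 1)‖ ≤ ‖z‖ ^ 2 * (1 / ((j : ℝ) + 1) ^ 2) := by
  have hj : (0 : ℝ) < (j : ℝ) + 1 := by positivity
  have hn : ‖z / ((j : ℂ) + 1)‖ = ‖z‖ / ((j : ℝ) + 1) := by
    rw [norm_div]
    congr 1
    exact_mod_cast Complex.norm_natCast (j + 1)
  have h2 : ‖z‖ / ((j : ℝ) + 1) ≤ 1 / 2 := by
    rw [div_le_iff₀ hj]; linarith
  refine (Complex.norm_log_one_add_sub_self_le (by rw [hn]; linarith)).trans ?_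
  rw [hn]
  have h3 : (1 - ‖z‖ / ((j : ℝ) + 1))⁻¹ ≤ 2 := by
    rw [inv_le_comm₀ (by linarith) (by norm_num)]
    norm_num; linarith
  calc (‖z‖ / ((j : ℝ) + 1)) ^ 2 * (1 - ‖z‖ / ((j : ℝ) + 1))⁻¹ / 2
      ≤ (‖z‖ / ((j : ℝ) + 1)) ^ 2 * 2 / 2 := by gcongr
    _ = _ := by field_simp

lemma summable_one_div_nat_add_one_sq : Summable fun j : ℕ => 1 / ((j : ℝ) + 1) ^ 2 := by
  have := (summable_nat_add_iff 1).2 (Real.summable_one_div_nat_pow.2 (by norm_num : 1 < 2))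
  simpa using this

lemma summable_logGamma_terms (z : ℂ) :
    Summable fun j : ℕ => Complex.log (1 + z / (j + 1)) - z / (j + 1) := by
  obtain ⟨N, hN⟩ := exists_nat_ge (2 * ‖z‖)
  rw [← summable_nat_add_iff N]
  refine Summable.of_norm_bounded (((summable_nat_add_iff N).2
    summable_one_div_nat_add_one_sq).mul_left (‖z‖ ^ 2)) fun j => ?_
  refine norm_log_one_add_div_sub_le ?_
  push_cast
  have : (0 : ℝ) ≤ j := by positivity
  linarith

lemma tendsto_logGammaPartial (z : ℂ) :
    Tendsto (fun n => logGammaPartial n z) atTop (𝓝 (logGamma z)) :=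
  (summable_logGamma_terms z).hasSum.tendsto_sum_nat.const_sub _

lemma continuousWithinAt_log_closedUpper {z : ℂ} (h0 : z ≠ 0) :
    ContinuousWithinAt Complex.log {z | 0 ≤ z.im} z := by
  by_cases h : z ∈ slitPlane
  · exact (continuousAt_clog h).continuousWithinAt
  · rw [Complex.mem_slitPlane_iff, not_or, not_lt, not_not] at h
    refine continuousWithinAt_log_of_re_neg_of_im_zero (lt_of_le_of_ne h.1 fun h' => h0 ?_) h.2
    exact Complex.ext h' h.2

lemma one_add_div_natCast_succ (z : ℂ) (j : ℕ) :
    1 + z / ((j : ℂ) + 1) = (z + ((j + 1 : ℕ) : ℂ)) / ((j + 1 : ℕ) : ℂ) := by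
  have : ((j : ℂ) + 1) ≠ 0 := by exact_mod_cast Nat.succ_ne_zero j
  push_cast
  field_simp
  ring

lemma one_add_div_natCast_succ_ne_zero {z : ℂ} (h : ∀ j : ℕ, z ≠ -j) (j : ℕ) :
    1 + z / ((j : ℂ) + 1) ≠ 0 := by
  rw [one_add_div_natCast_succ]
  refine div_ne_zero (fun h' => h (j + 1) (eq_neg_of_add_eq_zero_left h')) ?_
  exact_mod_cast Nat.succ_ne_zero j

lemma im_one_add_div (z : ℂ) (j : ℕ) :
    (1 + z / ((j : ℂ) + 1)).im = z.im / ((j : ℝ) + 1) := by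
  have : z / ((j : ℂ) + 1) = z / (((j : ℝ) + 1 : ℝ) : ℂ) := by push_cast; rfl
  rw [this, Complex.add_im, Complex.div_ofReal_im]; simp

lemma continuousWithinAt_logGamma_term {z : ℂ} (h : ∀ j : ℕ, z ≠ -j) (j : ℕ) :
    ContinuousWithinAt (fun w : ℂ => Complex.log (1 + w / (j + 1)) - w / (j + 1))
      {z | 0 ≤ z.im} z := by
  have hc : Continuous fun w : ℂ => 1 + w / ((j : ℂ) + 1) := by fun_prop
  refine ContinuousWithinAt.sub ?_ (by fun_prop)
  refine ContinuousWithinAt.comp (t := {z | 0 ≤ z.im})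
    (f := fun w : ℂ => 1 + w / ((j : ℂ) + 1)) (g := Complex.log) ?_ hc.continuousWithinAt ?_
  · exact continuousWithinAt_log_closedUpper (one_add_div_natCast_succ_ne_zero h j)
  · intro w hw
    simp only [Set.mem_ofPred_eq] at hw ⊢
    rw [im_one_add_div]; positivity

lemma continuousWithinAt_logGammaPartial {z : ℂ} (h : ∀ j : ℕ, z ≠ -j) (n : ℕ) :
    ContinuousWithinAt (logGammaPartial n) {z | 0 ≤ z.im} z := by
  refine ContinuousWithinAt.sub (ContinuousWithinAt.sub (by fun_prop)
    (continuousWithinAt_log_closedUpper (by simpa using h 0))) ?_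
  exact tendsto_finsetSum _ fun j _ => continuousWithinAt_logGamma_term h j

lemma continuousWithinAt_logGamma {z : ℂ} (h : ∀ j : ℕ, z ≠ -j) :
    ContinuousWithinAt logGamma {z | 0 ≤ z.im} z := by
  obtain ⟨N, hN⟩ := exists_nat_ge (2 * (‖z‖ + 1))
  have key : ∀ w, logGamma w = logGammaPartial N w -
      ∑' j : ℕ, (Complex.log (1 + w / ((j + N : ℕ) + 1)) - w / ((j + N : ℕ) + 1)) := by
    intro w
    rw [logGamma, logGammaPartial, ← (summable_logGamma_terms w).sum_add_tsum_nat_add N]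
    ring
  have : ContinuousWithinAt (fun w => ∑' j : ℕ, (Complex.log (1 + w / ((j + N : ℕ) + 1))
      - w / ((j + N : ℕ) + 1))) {z | 0 ≤ z.im} z := by
    refine tendsto_tsum_of_dominated_convergence (bound := fun j : ℕ => (‖z‖ + 1) ^ 2 *
      (1 / (((j + N : ℕ) : ℝ) + 1) ^ 2)) (((summable_nat_add_iff N).2
      summable_one_div_nat_add_one_sq).mul_left _)
      (fun j => continuousWithinAt_logGamma_term h (j + N)) ?_
    have hb : ∀ᶠ w in 𝓝[{z | 0 ≤ z.im}] z, ‖w‖ < ‖z‖ + 1 :=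
      (continuous_norm.continuousAt.eventually_lt continuousAt_const (by simp)).filter_mono
        nhdsWithin_le_nhds
    filter_upwards [hb] with w hw j
    refine (norm_log_one_add_div_sub_le ?_).trans (by gcongr)
    push_cast
    have : (0 : ℝ) ≤ j := by positivity
    linarith
  refine ((continuousWithinAt_logGammaPartial h N).sub this).congr (fun w _ => key w) (key z)

lemma exp_logGammaPartial {z : ℂ} (h : ∀ j : ℕ, z ≠ -j) {n : ℕ} (hn : n ≠ 0) :
    Complex.exp (logGammaPartial n z) = Complex.GammaSeq z n *
      Complex.exp (z * (((harmonic n : ℝ) - Real.log n : ℝ) - Real.eulerMascheroniConstant)) := by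
  have h0 : z ≠ 0 := by simpa using h 0
  have hn' : (n : ℂ) ≠ 0 := by exact_mod_cast hn
  have hprod : ∏ j ∈ Finset.range n, (1 + z / ((j : ℂ) + 1)) =
      (∏ j ∈ Finset.range n, (z + ((j + 1 : ℕ) : ℂ))) / (n.factorial : ℂ) := by
    rw [← Finset.prod_range_add_one_eq_factorial, Nat.cast_prod, ← Finset.prod_div_distrib]
    exact Finset.prod_congr rfl fun j _ => one_add_div_natCast_succ z j
  have hne : ∏ j ∈ Finset.range n, (z + ((j + 1 : ℕ) : ℂ)) ≠ 0 :=
    Finset.prod_ne_zero_iff.2 fun j _ h' => h (j + 1) (eq_neg_of_add_eq_zero_left h')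
  have hexp : Complex.exp (∑ j ∈ Finset.range n,
      (Complex.log (1 + z / ((j : ℂ) + 1)) - z / ((j : ℂ) + 1))) =
      (∏ j ∈ Finset.range n, (1 + z / ((j : ℂ) + 1))) / Complex.exp (z * (harmonic n : ℝ)) := by
    rw [Complex.exp_sum, Finset.prod_congr rfl fun j _ => by
      rw [Complex.exp_sub, Complex.exp_log (one_add_div_natCast_succ_ne_zero h j)],
      Finset.prod_div_distrib, ← Complex.exp_sum]
    simp [harmonic, Finset.mul_sum, div_eq_mul_inv]
  have hfac : (n.factorial : ℂ) ≠ 0 := by exact_mod_cast n.factorial_ne_zero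
  rw [logGammaPartial, Complex.exp_sub, Complex.exp_sub, Complex.exp_log h0, hexp, hprod,
    Complex.GammaSeq, Finset.prod_range_succ', Complex.cpow_def_of_ne_zero hn',
    ← Complex.natCast_log]
  have e1 : z * ((((harmonic n : ℝ) - Real.log n : ℝ) : ℂ) - Real.eulerMascheroniConstant) =
      -(Real.eulerMascheroniConstant : ℂ) * z + z * (harmonic n : ℝ) - Real.log n * z := by
    push_cast; ring
  rw [e1, Complex.exp_sub, Complex.exp_add]
  have := Complex.exp_ne_zero (Real.log n * z)
  have := Complex.exp_ne_zero (z * (harmonic n : ℝ))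
  simp only [Nat.cast_zero, add_zero]
  field_simp

lemma exp_logGamma {z : ℂ} (h : ∀ j : ℕ, z ≠ -j) :
    Complex.exp (logGamma z) = Complex.Gamma z := by
  refine tendsto_nhds_unique ((Complex.continuous_exp.tendsto _).comp
    (tendsto_logGammaPartial z)) ?_
  have h1 : Tendsto (fun n : ℕ => z * ((((harmonic n : ℝ) - Real.log n : ℝ) : ℂ) -
      Real.eulerMascheroniConstant)) atTop (𝓝 (z * 0)) := by
    refine Tendsto.const_mul _ ?_
    have := (Complex.continuous_ofReal.tendsto _).comp Real.tendsto_harmonic_sub_log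
    simpa using this.sub_const (Real.eulerMascheroniConstant : ℂ)
  have h2 := (Complex.GammaSeq_tendsto_Gamma z).mul ((Complex.continuous_exp.tendsto _).comp h1)
  rw [mul_zero, Complex.exp_zero, mul_one] at h2
  refine h2.congr' ?_
  filter_upwards [eventually_ne_atTop 0] with n hn
  simp only [Function.comp]
  rw [exp_logGammaPartial h hn]

lemma arg_eq_of_im_pos {z : ℂ} (hz : 0 < z.im) :
    Complex.arg z = Real.pi / 2 - Real.arctan (z.re / z.im) := by
  set u := z.re / z.im with hu
  have hs : 0 < Real.sqrt (1 + u ^ 2) := Real.sqrt_pos.2 (by positivity)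
  have hre : z.re = u * z.im := by rw [hu]; field_simp
  have hzeq : z = ((z.im * Real.sqrt (1 + u ^ 2) : ℝ) : ℂ) *
      (Complex.cos ((Real.pi / 2 - Real.arctan u : ℝ) : ℂ) +
        Complex.sin ((Real.pi / 2 - Real.arctan u : ℝ) : ℂ) * I) := by
    rw [← Complex.ofReal_cos, ← Complex.ofReal_sin, Real.cos_pi_div_two_sub,
      Real.sin_pi_div_two_sub, Real.sin_arctan, Real.cos_arctan]
    apply Complex.ext
    · simp only [mul_re, add_re, ofReal_re, ofReal_im, I_re, I_im, add_im, mul_im]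
      rw [hre]; field_simp; ring
    · simp only [mul_re, add_re, ofReal_re, ofReal_im, I_re, I_im, add_im, mul_im]
      field_simp; ring
  conv_lhs => rw [hzeq]
  refine Complex.arg_mul_cos_add_sin_mul_I (by positivity) ⟨?_, ?_⟩
  · linarith [Real.arctan_lt_pi_div_two u, Real.pi_pos]
  · linarith [Real.neg_pi_div_two_lt_arctan u]

lemma arg_one_add_div (z : ℂ) (j : ℕ) :
    Complex.arg (1 + z / ((j : ℂ) + 1)) = Complex.arg (z + ((j + 1 : ℕ) : ℂ)) := by
  have h : 1 + z / ((j : ℂ) + 1) = (((j : ℝ) + 1)⁻¹ : ℝ) * (z + ((j + 1 : ℕ) : ℂ)) := by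
    rw [one_add_div_natCast_succ]; push_cast; ring
  rw [h, Complex.arg_real_mul _ (by positivity)]

lemma im_logGammaPartial (n : ℕ) (z : ℂ) :
    (logGammaPartial n z).im = z.im * (∑ j ∈ Finset.range n, 1 / ((j : ℝ) + 1) -
      Real.eulerMascheroniConstant) - ∑ j ∈ Finset.range (n + 1), Complex.arg (z + (j : ℂ)) := by
  have h : ∀ j : ℕ, (z / ((j : ℂ) + 1)).im = z.im * (1 / ((j : ℝ) + 1)) := by
    intro j
    have := im_one_add_div z j
    rw [Complex.add_im, Complex.one_im, zero_add] at this
    rw [this, mul_one_div]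
  rw [logGammaPartial, Finset.sum_range_succ']
  simp only [Complex.sub_im, Complex.im_sum, Complex.log_im, arg_one_add_div, h,
    Finset.sum_sub_distrib, Complex.mul_im, Complex.neg_im, Complex.neg_re, Complex.ofReal_im,
    Complex.ofReal_re, ← Finset.mul_sum, Nat.cast_zero, add_zero]
  ring

lemma tendsto_im_logGammaPartial (z : ℂ) :
    Tendsto (fun n => (logGammaPartial n z).im) atTop (𝓝 (logGamma z).im) :=
  (Complex.continuous_im.tendsto _).comp (tendsto_logGammaPartial z)

lemma arg_add_natCast {z : ℂ} (hz : 0 < z.im) (j : ℕ) :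
    Complex.arg (z + (j : ℂ)) = Real.pi / 2 - Real.arctan ((z.re + j) / z.im) := by
  rw [arg_eq_of_im_pos (by simpa using hz)]; simp

/-- On horizontal lines of the upper half plane the imaginary part of `logGamma` is monotone. -/
lemma im_logGamma_mono {z w : ℂ} (hz : 0 < z.im) (him : z.im = w.im) (hre : z.re ≤ w.re) :
    (logGamma z).im ≤ (logGamma w).im := by
  refine le_of_tendsto_of_tendsto' (tendsto_im_logGammaPartial z) (tendsto_im_logGammaPartial w)
    fun n => ?_
  rw [im_logGammaPartial, im_logGammaPartial, ← him]
  refine sub_le_sub_left (Finset.sum_le_sum fun j _ => ?_) _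
  rw [arg_add_natCast hz, arg_add_natCast (him ▸ hz), ← him]
  refine sub_le_sub_left (Real.arctan_mono ?_) _
  gcongr

lemma im_logGamma_le_sub {z : ℂ} (hz : 0 < z.im) (hz1 : z.im ≤ 1) {N : ℕ} (hN : z.re ≤ -N) :
    (logGamma z).im ≤ (logGamma (2 + z.im * I)).im - N * (Real.pi / 4) := by
  refine le_of_tendsto_of_tendsto (tendsto_im_logGammaPartial z)
    ((tendsto_im_logGammaPartial _).sub_const _) ?_
  filter_upwards [eventually_ge_atTop N] with n hn
  rw [im_logGammaPartial, im_logGammaPartial]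
  have him : ((2 : ℂ) + z.im * I).im = z.im := by simp
  have hre : ((2 : ℂ) + z.im * I).re = 2 := by simp
  rw [him, sub_sub]
  refine sub_le_sub_left ?_ _
  obtain ⟨m, hm⟩ := Nat.exists_eq_add_of_le (hn.trans n.le_succ)
  rw [Nat.succ_eq_add_one] at hm
  rw [hm, Finset.sum_range_add, Finset.sum_range_add]
  have h1 : ∑ j ∈ Finset.range N, Complex.arg (2 + z.im * I + (j : ℂ)) + N * (Real.pi / 4) ≤
      ∑ j ∈ Finset.range N, Complex.arg (z + (j : ℂ)) := by
    have : (N : ℝ) * (Real.pi / 4) = ∑ j ∈ Finset.range N, Real.pi / 4 := by simp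
    rw [this, ← Finset.sum_add_distrib]
    refine Finset.sum_le_sum fun j hj => ?_
    rw [arg_add_natCast hz, arg_add_natCast (by rw [him]; exact hz), him, hre]
    have hj' : (j : ℝ) ≤ N := by exact_mod_cast (Finset.mem_range.1 hj).le
    have e1 : Real.arctan ((z.re + j) / z.im) ≤ 0 := by
      rw [← Real.arctan_zero]
      exact Real.arctan_mono (div_nonpos_of_nonpos_of_nonneg (by linarith) hz.le)
    have e2 : Real.pi / 4 ≤ Real.arctan ((2 + j) / z.im) := by
      rw [← Real.arctan_one]
      refine Real.arctan_mono ?_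
      rw [one_le_div hz]
      have : (0 : ℝ) ≤ j := by positivity
      linarith
    linarith
  have h2 : ∑ j ∈ Finset.range m, Complex.arg (2 + z.im * I + ((N + j : ℕ) : ℂ)) ≤
      ∑ j ∈ Finset.range m, Complex.arg (z + ((N + j : ℕ) : ℂ)) := by
    refine Finset.sum_le_sum fun j _ => ?_
    rw [arg_add_natCast hz, arg_add_natCast (by rw [him]; exact hz), him, hre]
    refine sub_le_sub_left (Real.arctan_mono ?_) _
    have : (0 : ℝ) ≤ N := by positivity
    gcongr
    linarith
  linarith

lemma im_logGamma_pos {z : ℂ} (hz : 0 < z.im) (hre : 2 ≤ z.re) : 0 < (logGamma z).im := by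
  have hγ := Real.eulerMascheroniConstant_lt_two_thirds
  refine lt_of_lt_of_le (by positivity : 0 < z.im / 6) ?_
  refine ge_of_tendsto (tendsto_im_logGammaPartial z) ?_
  filter_upwards [eventually_ge_atTop 11] with n hn
  have harg : ∀ j : ℕ, Complex.arg (z + (j : ℂ)) ≤ z.im * (1 / ((j : ℝ) + 2)) := by
    intro j
    have hj : (0 : ℝ) ≤ j := by positivity
    have hpos : 0 < (z.re + j) / z.im := by apply div_pos <;> linarith
    rw [arg_add_natCast hz, ← Real.arctan_inv_of_pos hpos, inv_div]
    have hu : 0 ≤ z.im / (z.re + j) := by apply div_nonneg <;> linarith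
    have hle := Real.le_tan (Real.arctan_nonneg.2 hu) (Real.arctan_lt_pi_div_two _)
    rw [Real.tan_arctan] at hle
    refine hle.trans ?_
    rw [mul_one_div]
    exact div_le_div_of_nonneg_left hz.le (by positivity) (by linarith)
  have hsum : ∀ m : ℕ, ∑ j ∈ Finset.range m, 1 / ((j : ℝ) + 1) -
      ∑ j ∈ Finset.range (m + 1), 1 / ((j : ℝ) + 2) =
      1 - 1 / ((m : ℝ) + 1) - 1 / ((m : ℝ) + 2) := by
    intro m
    induction m with
    | zero => norm_num
    | succ m ih =>
      rw [Finset.sum_range_succ, Finset.sum_range_succ _ (m + 1)]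
      push_cast
      have e1 : (m : ℝ) + 1 + 1 = m + 2 := by ring
      rw [e1]
      linarith
  have hS := Finset.sum_le_sum fun j (_ : j ∈ Finset.range (n + 1)) => harg j
  rw [← Finset.mul_sum] at hS
  rw [im_logGammaPartial]
  have hn' : (11 : ℝ) ≤ n := by exact_mod_cast hn
  have e1 : 1 / ((n : ℝ) + 1) ≤ 1 / 12 := by gcongr; linarith
  have e2 : 1 / ((n : ℝ) + 2) ≤ 1 / 12 := by gcongr; linarith
  have := hsum n
  have : z.im * (1 / 6) ≤ z.im * (∑ j ∈ Finset.range n, 1 / ((j : ℝ) + 1) -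
      ∑ j ∈ Finset.range (n + 1), 1 / ((j : ℝ) + 2) - Real.eulerMascheroniConstant) := by
    gcongr; linarith
  nlinarith

/-- On `(-k, -k+1)` the boundary value of `logGamma` has imaginary part `-kπ`. -/
lemma im_logGamma_ofReal {x : ℝ} {k : ℕ} (hneg : ∀ j < k, x + (j : ℝ) < 0) (hpos : 0 < x + k) :
    (logGamma x).im = -(k * Real.pi) := by
  refine tendsto_nhds_unique (tendsto_im_logGammaPartial (x : ℂ))
    (tendsto_const_nhds.congr' ?_)
  filter_upwards [eventually_ge_atTop k] with n hn
  rw [im_logGammaPartial]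
  obtain ⟨m, hm⟩ := Nat.exists_eq_add_of_le (hn.trans n.le_succ)
  rw [Nat.succ_eq_add_one] at hm
  rw [hm, Finset.sum_range_add]
  have h1 : ∑ j ∈ Finset.range k, Complex.arg ((x : ℂ) + (j : ℂ)) = k * Real.pi := by
    rw [Finset.sum_congr rfl fun j hj => ?_]
    · rw [Finset.sum_const, Finset.card_range, nsmul_eq_mul]
    · have := Complex.arg_ofReal_of_neg (hneg j (Finset.mem_range.1 hj))
      push_cast at this
      exact this
  have h2 : ∑ j ∈ Finset.range m, Complex.arg ((x : ℂ) + ((k + j : ℕ) : ℂ)) = 0 := by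
    refine Finset.sum_eq_zero fun j _ => ?_
    have := Complex.arg_ofReal_of_nonneg (x := x + ((k + j : ℕ) : ℝ)) (by
      have : (0 : ℝ) ≤ j := by positivity
      push_cast; linarith)
    push_cast at this ⊢
    exact this
  rw [h1, h2]; simp

lemma ofReal_ne_neg_natCast {x : ℝ} {k : ℕ} (hneg : ∀ j < k, x + (j : ℝ) < 0)
    (hpos : 0 < x + k) (j : ℕ) : (x : ℂ) ≠ -j := by
  intro h
  have h' : x = -(j : ℝ) := by exact_mod_cast h
  rcases lt_or_ge j k with hj | hj
  · linarith [hneg j hj]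
  · have : (k : ℝ) ≤ j := by exact_mod_cast hj
    linarith

lemma Gamma_eq_neg_one_pow_mul_exp {x : ℝ} {k : ℕ} (hneg : ∀ j < k, x + (j : ℝ) < 0)
    (hpos : 0 < x + k) : Real.Gamma x = (-1) ^ k * Real.exp (logGamma x).re := by
  have h := exp_logGamma (ofReal_ne_neg_natCast hneg hpos)
  rw [← Complex.re_add_im (logGamma x), im_logGamma_ofReal hneg hpos, Complex.exp_add,
    Complex.Gamma_ofReal] at h
  have h2 : Complex.exp (((-(k * Real.pi) : ℝ) : ℂ) * I) = (-1) ^ k := by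
    have : ((-(k * Real.pi) : ℝ) : ℂ) * I = k * (-(Real.pi * I)) := by push_cast; ring
    rw [this, Complex.exp_nat_mul, Complex.exp_neg, Complex.exp_pi_mul_I]
    norm_num
  rw [h2] at h
  have h3 : ((Real.exp (logGamma x).re * (-1) ^ k : ℝ) : ℂ) = (Real.Gamma x : ℂ) := by
    push_cast; exact h
  rw [← Complex.ofReal_inj.1 h3, mul_comm]

lemma logGamma_ofReal_eq {x : ℝ} {k : ℕ} (hneg : ∀ j < k, x + (j : ℝ) < 0) (hpos : 0 < x + k) :
    logGamma x = Real.log (Real.Gamma x) - k * Real.pi * I := by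
  have hG := Gamma_eq_neg_one_pow_mul_exp hneg hpos
  have h1 : Real.log (Real.Gamma x) = (logGamma x).re := by
    rw [← Real.log_abs, hG, abs_mul, abs_pow, abs_neg, abs_one, one_pow, one_mul,
      Real.abs_exp, Real.log_exp]
  have := im_logGamma_ofReal hneg hpos
  apply Complex.ext
  · simp [h1]
  · simp [this]

lemma add_natCast_mem_slitPlane {z : ℂ} (hz : 0 < z.im) (j : ℕ) : z + (j : ℂ) ∈ slitPlane :=
  Complex.mem_slitPlane_iff.2 (Or.inr (by simpa using hz.ne'))

lemma hasDerivAt_logGammaPartial (n : ℕ) {z : ℂ} (hz : 0 < z.im) :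
    HasDerivAt (logGammaPartial n) (((∑ j ∈ Finset.range n, 1 / ((j : ℝ) + 1) -
      Real.eulerMascheroniConstant : ℝ) : ℂ) - ∑ j ∈ Finset.range (n + 1), (z + (j : ℂ))⁻¹) z := by
  have hz0 : z ∈ slitPlane := by simpa using add_natCast_mem_slitPlane hz 0
  have hterm : ∀ j : ℕ, HasDerivAt (fun w : ℂ => Complex.log (1 + w / (j + 1)) - w / (j + 1))
      ((z + ((j + 1 : ℕ) : ℂ))⁻¹ - 1 / ((j : ℂ) + 1)) z := by
    intro j
    have hj : (j : ℂ) + 1 ≠ 0 := by exact_mod_cast Nat.succ_ne_zero j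
    have hd : HasDerivAt (fun w : ℂ => w / ((j : ℂ) + 1)) (1 / ((j : ℂ) + 1)) z :=
      (hasDerivAt_id z).div_const _
    have hs : 1 + z / ((j : ℂ) + 1) ∈ slitPlane := by
      refine Complex.mem_slitPlane_iff.2 (Or.inr ?_)
      rw [im_one_add_div]; positivity
    have h1 := ((hd.const_add 1).clog hs).sub hd
    refine h1.congr_deriv ?_
    rw [one_add_div_natCast_succ]
    have := Complex.slitPlane_ne_zero (add_natCast_mem_slitPlane hz (j + 1))
    push_cast at this ⊢
    field_simp
  have h := (((hasDerivAt_id z).const_mul (-(Real.eulerMascheroniConstant : ℂ))).sub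
    (Complex.hasDerivAt_log hz0)).sub (HasDerivAt.fun_sum fun j (_ : j ∈ Finset.range n) => hterm j)
  refine h.congr_deriv ?_
  rw [Finset.sum_range_succ', Finset.sum_sub_distrib]
  push_cast
  ring

lemma im_deriv_logGammaPartial (n : ℕ) (z : ℂ) :
    ((((∑ j ∈ Finset.range n, 1 / ((j : ℝ) + 1) -
      Real.eulerMascheroniConstant : ℝ) : ℂ) - ∑ j ∈ Finset.range (n + 1), (z + (j : ℂ))⁻¹)).im =
      ∑ j ∈ Finset.range (n + 1), z.im / ((z.re + j) ^ 2 + z.im ^ 2) := by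
  rw [Complex.sub_im, Complex.ofReal_im, Complex.im_sum, zero_sub, ← Finset.sum_neg_distrib]
  refine Finset.sum_congr rfl fun j _ => ?_
  rw [Complex.inv_im, Complex.normSq_apply]
  simp only [add_im, natCast_im, add_zero, add_re, natCast_re, neg_div, neg_neg]
  congr 1; ring

/-- A lower bound for the imaginary part of the derivative along a segment bounds the increment
of the partial sums along that segment from below. -/
lemma le_im_logGammaPartial_sub_mul_conj {n : ℕ} {p q : ℂ} (hp : 0 < p.im) (hq : 0 < q.im)
    {α β : ℝ} (h : ∀ z : ℂ, ∀ s ∈ Set.Icc (0 : ℝ) 1, z = p + s * (q - p) →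
      α + β * s ≤ ∑ j ∈ Finset.range (n + 1), z.im / ((z.re + j) ^ 2 + z.im ^ 2)) :
    (α + β / 2) * ‖q - p‖ ^ 2 ≤
      ((logGammaPartial n q - logGammaPartial n p) * conj (q - p)).im := by
  set φ : ℝ → ℝ := fun s => (logGammaPartial n (p + s * (q - p)) * conj (q - p)).im -
    ‖q - p‖ ^ 2 * (α * s + β / 2 * s ^ 2) with hφ
  have him : ∀ s ∈ Set.Icc (0 : ℝ) 1, 0 < (p + s * (q - p)).im := by
    intro s hs
    simp only [add_im, mul_im, ofReal_re, ofReal_im, sub_im, zero_mul, add_zero]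
    rcases eq_or_lt_of_le hs.1 with h0 | h0
    · rw [← h0]; simpa using hp
    · nlinarith [hs.2]
  have hder : ∀ s ∈ Set.Icc (0 : ℝ) 1, HasDerivAt φ
      (‖q - p‖ ^ 2 * ∑ j ∈ Finset.range (n + 1), (p + s * (q - p)).im /
        (((p + s * (q - p)).re + j) ^ 2 + (p + s * (q - p)).im ^ 2) -
        ‖q - p‖ ^ 2 * (α + β * s)) s := by
    intro s hs
    have h1 : HasDerivAt (fun s : ℂ => p + s * (q - p)) (q - p) (s : ℂ) := by
      simpa using ((hasDerivAt_id (s : ℂ)).mul_const (q - p)).const_add p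
    have h2 := (((hasDerivAt_logGammaPartial n (him s hs)).comp (s : ℂ) h1).mul_const
      (conj (q - p))).comp_ofReal
    have h3 := Complex.imCLM.hasFDerivAt.comp_hasDerivAt s h2
    have h4 : HasDerivAt (fun s : ℝ => ‖q - p‖ ^ 2 * (α * s + β / 2 * s ^ 2))
        (‖q - p‖ ^ 2 * (α + β * s)) s := by
      have := (((hasDerivAt_id s).const_mul α).add
        (((hasDerivAt_id s).pow 2).const_mul (β / 2))).const_mul (‖q - p‖ ^ 2)
      refine this.congr_deriv ?_
      simp only [id, Nat.cast_ofNat, Nat.add_one_sub_one, pow_one]; ring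
    refine (h3.sub h4).congr_deriv ?_
    rw [← im_deriv_logGammaPartial, mul_assoc, Complex.mul_conj, Complex.normSq_eq_norm_sq]
    simp only [Complex.imCLM_apply, Complex.im_mul_ofReal]
    ring
  have hmono : MonotoneOn φ (Set.Icc 0 1) := by
    refine monotoneOn_of_hasDerivWithinAt_nonneg (convex_Icc 0 1)
      (fun s hs => (hder s hs).continuousAt.continuousWithinAt)
      (fun s hs => (hder s (interior_subset hs)).hasDerivWithinAt) fun s hs => ?_
    rw [← mul_sub]
    exact mul_nonneg (by positivity) (sub_nonneg.2 (h _ s (interior_subset hs) rfl))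
  have h01 := hmono (Set.left_mem_Icc.2 zero_le_one) (Set.right_mem_Icc.2 zero_le_one) zero_le_one
  simp only [hφ, ofReal_zero, ofReal_one, zero_mul, one_mul, add_zero, mul_zero,
    add_sub_cancel] at h01
  rw [sub_mul, Complex.sub_im]
  norm_num at h01 ⊢
  linarith

lemma min_one_div_le_sum {a b : ℝ} (ha : a ≤ 2) (hb : 0 < b) {n : ℕ} (hn : |a| + b + 2 ≤ n) :
    min 1 b / 10 ≤ ∑ j ∈ Finset.range (n + 1), b / ((a + j) ^ 2 + b ^ 2) := by
  set i := ⌈-a⌉₊ with hi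
  have hi0 : 0 ≤ a + i := by linarith [Nat.le_ceil (-a)]
  have hi2 : a + i ≤ 2 := by
    rcases le_or_gt 0 a with h | h
    · rw [hi, Nat.ceil_eq_zero.2 (by linarith)]; simpa using ha
    · linarith [Nat.ceil_lt_add_one (neg_nonneg.2 h.le)]
  have hia : (i : ℝ) ≤ |a| + 1 := by
    rcases le_or_gt 0 a with h | h
    · rw [hi, Nat.ceil_eq_zero.2 (by linarith)]; push_cast; positivity
    · linarith [Nat.ceil_lt_add_one (neg_nonneg.2 h.le), neg_le_abs a]
  have hnn : ∀ j : ℕ, 0 ≤ b / ((a + j) ^ 2 + b ^ 2) := fun j => by positivity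
  rcases lt_or_ge b 1 with h1 | h1
  · rw [min_eq_right h1.le]
    have hmem : i ∈ Finset.range (n + 1) := by
      rw [Finset.mem_range]
      have : (i : ℝ) < ((n + 1 : ℕ) : ℝ) := by push_cast; linarith
      exact_mod_cast this
    refine le_trans ?_ (Finset.single_le_sum (fun j _ => hnn j) hmem)
    refine div_le_div_of_nonneg_left hb.le (by positivity) ?_
    nlinarith
  · rw [min_eq_left h1]
    set m := ⌈b⌉₊ with hm
    have hm1 : b ≤ m := Nat.le_ceil b
    have hm2 : (m : ℝ) < b + 1 := Nat.ceil_lt_add_one hb.le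
    have hle : i + m ≤ n + 1 := by
      have : ((i + m : ℕ) : ℝ) ≤ ((n + 1 : ℕ) : ℝ) := by push_cast; linarith
      exact_mod_cast this
    obtain ⟨l, hl⟩ := Nat.exists_eq_add_of_le hle
    rw [hl, Finset.sum_range_add, Finset.sum_range_add]
    have hA : 0 ≤ ∑ j ∈ Finset.range i, b / ((a + j) ^ 2 + b ^ 2) :=
      Finset.sum_nonneg fun j _ => hnn j
    have hB : 0 ≤ ∑ j ∈ Finset.range l, b / ((a + ((i + m + j : ℕ) : ℝ)) ^ 2 + b ^ 2) :=
      Finset.sum_nonneg fun j _ => hnn _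
    have hC : ∑ j ∈ Finset.range m, 1 / (10 * b) ≤
        ∑ j ∈ Finset.range m, b / ((a + ((i + j : ℕ) : ℝ)) ^ 2 + b ^ 2) := by
      refine Finset.sum_le_sum fun j hj => ?_
      have hj : (j : ℝ) + 1 ≤ m := by exact_mod_cast Finset.mem_range.1 hj
      have hj0 : (0 : ℝ) ≤ j := by positivity
      push_cast
      rw [div_le_div_iff₀ (by positivity) (by positivity)]
      have h3 : a + ((i : ℝ) + j) ≤ 3 * b := by linarith
      have h4 : 0 ≤ a + ((i : ℝ) + j) := by linarith
      nlinarith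
    rw [Finset.sum_const, Finset.card_range, nsmul_eq_mul] at hC
    have : (1 : ℝ) / 10 ≤ m * (1 / (10 * b)) := by
      rw [mul_one_div, div_le_div_iff₀ (by norm_num) (by positivity)]
      linarith
    linarith

lemma tendsto_im_logGammaPartial_sub_mul_conj (p q : ℂ) :
    Tendsto (fun n => ((logGammaPartial n q - logGammaPartial n p) * conj (q - p)).im) atTop
      (𝓝 ((logGamma q - logGamma p) * conj (q - p)).im) :=
  (Complex.continuous_im.tendsto _).comp
    (((tendsto_logGammaPartial q).sub (tendsto_logGammaPartial p)).mul_const _)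

lemma norm_sq_le_im_logGamma_sub {w : ℂ} (hw : 0 < w.im) (hre : w.re ≤ 2) :
    1 / 20 * ‖w - (2 + I)‖ ^ 2 ≤
      ((logGamma w - logGamma (2 + I)) * conj (w - (2 + I))).im := by
  refine ge_of_tendsto (tendsto_im_logGammaPartial_sub_mul_conj (2 + I) w) ?_
  obtain ⟨N, hN⟩ := exists_nat_ge (|w.re| + w.im + 5)
  filter_upwards [eventually_ge_atTop N] with n hn
  have hn' : (N : ℝ) ≤ n := by exact_mod_cast hn
  have := le_im_logGammaPartial_sub_mul_conj (n := n) (p := 2 + I) (q := w) (by simp) hw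
    (α := 1 / 10) (β := -(1 / 10)) ?_
  · refine le_trans (le_of_eq ?_) this; norm_num
  · intro z s hs hz
    have hzre : z.re = 2 + s * (w.re - 2) := by rw [hz]; simp
    have hzim : z.im = 1 + s * (w.im - 1) := by rw [hz]; simp
    have h1 : z.re ≤ 2 := by rw [hzre]; nlinarith [hs.1]
    have h2 : 1 - s ≤ z.im := by rw [hzim]; nlinarith [hs.1]
    have h3 : 0 < z.im := by
      rw [hzim]
      rcases eq_or_lt_of_le hs.1 with h0 | h0
      · rw [← h0]; norm_num
      · nlinarith [hs.2]
    have h4 : |z.re| ≤ |w.re| + 2 := by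
      have e1 := neg_abs_le w.re
      rw [abs_le]
      constructor
      · rw [hzre]; nlinarith [hs.1, hs.2, abs_nonneg w.re]
      · linarith [abs_nonneg w.re]
    have h5 : z.im ≤ w.im + 1 := by rw [hzim]; nlinarith [hs.1, hs.2]
    refine le_trans ?_ (min_one_div_le_sum h1 h3 (n := n) (by linarith))
    have : 1 - s ≤ min 1 z.im := le_min (by linarith [hs.1]) h2
    linarith

/-- Points of the upper half plane are quantitatively separated by `logGamma` from the real
points that are not poles. -/
lemma im_sq_le_norm_logGamma_sub {w : ℂ} (hw : 0 < w.im) {x : ℝ} (hx : ∀ j : ℕ, (x : ℂ) ≠ -j)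
    {M : ℝ} (hwM : ‖w‖ ≤ M) (hxM : |x| + 1 ≤ M) :
    w.im / (2 * M ^ 2) * w.im ≤ ‖logGamma w - logGamma x‖ := by
  have hM : 0 < M := by linarith [abs_nonneg x]
  have hne : w - x ≠ 0 := fun h => hw.ne' (by simpa using congrArg Complex.im h)
  have key : ∀ n : ℕ, w.im / (2 * M ^ 2) * ‖w - x‖ ^ 2 ≤
      ((logGammaPartial n w - logGammaPartial n x) * conj (w - x)).im := by
    intro n
    have hlim : Tendsto (fun ε : ℝ => (x : ℂ) + ε * I) (𝓝[>] 0) (𝓝[{z | 0 ≤ z.im}] (x : ℂ)) := by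
      refine tendsto_nhdsWithin_iff.2 ⟨?_, ?_⟩
      · have : Continuous fun ε : ℝ => (x : ℂ) + ε * I := by fun_prop
        have h := this.tendsto 0
        simp only [ofReal_zero, zero_mul, add_zero] at h
        exact h.mono_left nhdsWithin_le_nhds
      · filter_upwards [self_mem_nhdsWithin] with ε hε
        simpa using (Set.mem_Ioi.1 hε).le
    have hlim' := hlim.mono_right nhdsWithin_le_nhds
    have hL := (continuousWithinAt_logGammaPartial hx n).tendsto.comp hlim
    have h1 : Tendsto (fun ε : ℝ => w.im / (2 * M ^ 2) * ‖w - (x + ε * I)‖ ^ 2) (𝓝[>] 0)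
        (𝓝 (w.im / (2 * M ^ 2) * ‖w - x‖ ^ 2)) :=
      ((hlim'.const_sub w).norm.pow 2).const_mul _
    have h2 : Tendsto (fun ε : ℝ => ((logGammaPartial n w - logGammaPartial n (x + ε * I)) *
        conj (w - (x + ε * I))).im) (𝓝[>] 0)
        (𝓝 ((logGammaPartial n w - logGammaPartial n x) * conj (w - x)).im) :=
      (Complex.continuous_im.tendsto _).comp ((hL.const_sub _).mul
        ((Complex.continuous_conj.tendsto _).comp (hlim'.const_sub w)))
    refine le_of_tendsto_of_tendsto h1 h2 ?_
    filter_upwards [Ioo_mem_nhdsGT (zero_lt_one (α := ℝ))] with ε hε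
    have := le_im_logGammaPartial_sub_mul_conj (n := n) (p := x + ε * I) (q := w)
      (by simpa using hε.1) hw (α := 0) (β := w.im / M ^ 2) ?_
    · refine le_trans (le_of_eq ?_) this
      field_simp; ring
    · intro z s hs hz
      have hzim : s * w.im ≤ z.im := by
        have : z.im = ε + s * (w.im - ε) := by rw [hz]; simp
        rw [this]; nlinarith [hs.2, hε.1]
      have hzn : ‖z‖ ≤ M := by
        have e1 : z = ((1 - s : ℝ) : ℂ) * (x + ε * I) + (s : ℂ) * w := by
          rw [hz]; push_cast; ring
        have e2 : ‖(x : ℂ) + ε * I‖ ≤ M := by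
          refine (norm_add_le _ _).trans ?_
          simp only [norm_real, norm_mul, norm_I, mul_one, Real.norm_eq_abs]
          rw [abs_of_pos hε.1]; linarith [hε.2]
        rw [e1]
        refine (norm_add_le _ _).trans ?_
        rw [norm_mul, norm_mul, norm_real, norm_real, Real.norm_of_nonneg hs.1,
          Real.norm_of_nonneg (by linarith [hs.2])]
        nlinarith [hs.1, hs.2]
      have hz0 : 0 < z.im := by
        have : z.im = ε + s * (w.im - ε) := by rw [hz]; simp
        rw [this]
        rcases eq_or_lt_of_le hs.1 with h0 | h0
        · rw [← h0]; linarith [hε.1]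
        · nlinarith [hs.2, hε.1]
      refine le_trans ?_ (Finset.single_le_sum (f := fun j : ℕ => z.im /
        ((z.re + j) ^ 2 + z.im ^ 2)) (fun j _ => by positivity)
        (Finset.mem_range.2 n.succ_pos))
      have e3 : (z.re + ((0 : ℕ) : ℝ)) ^ 2 + z.im ^ 2 ≤ M ^ 2 := by
        have : ‖z‖ ^ 2 = z.re ^ 2 + z.im ^ 2 := by
          rw [← Complex.normSq_eq_norm_sq, Complex.normSq_apply]; ring
        rw [Nat.cast_zero, add_zero, ← this]
        gcongr
      calc 0 + w.im / M ^ 2 * s = s * w.im / M ^ 2 := by ring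
        _ ≤ z.im / M ^ 2 := by gcongr
        _ ≤ _ := div_le_div_of_nonneg_left hz0.le (by positivity) e3
  have h := ge_of_tendsto' (tendsto_im_logGammaPartial_sub_mul_conj (x : ℂ) w) key
  have h3 : ((logGamma w - logGamma x) * conj (w - x)).im ≤
      ‖logGamma w - logGamma x‖ * ‖w - x‖ := by
    refine (Complex.im_le_norm _).trans (le_of_eq ?_)
    rw [norm_mul, RCLike.norm_conj]
  have hpos : 0 < ‖w - x‖ := norm_pos_iff.2 hne
  have h4 : w.im / (2 * M ^ 2) * ‖w - x‖ ≤ ‖logGamma w - logGamma x‖ := by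
    refine le_of_mul_le_mul_right ?_ hpos
    nlinarith
  refine le_trans ?_ h4
  have : w.im ≤ ‖w - x‖ := by simpa using Complex.im_le_norm (w - x)
  gcongr

open MeasureTheory in
lemma integral_eq_zero_of_decay {q : ℂ → ℂ} {ε : ℝ} (hε : 0 < ε)
    (hq : DifferentiableOn ℂ q {w | -ε < w.im}) (hi : Integrable fun t : ℝ => q t)
    {C R₀ : ℝ} (hC : 0 ≤ C) (hb : ∀ w : ℂ, 0 ≤ w.im → R₀ ≤ ‖w‖ → ‖q w‖ ≤ C / ‖w‖ ^ 2) :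
    ∫ t : ℝ, q t = 0 := by
  have hlim := intervalIntegral_tendsto_integral hi tendsto_neg_atTop_atBot tendsto_id
  refine tendsto_nhds_unique hlim (squeeze_zero_norm' (a := fun R : ℝ => 4 * C / R) ?_
    (tendsto_const_nhds.div_atTop tendsto_id))
  filter_upwards [eventually_ge_atTop R₀, eventually_gt_atTop 0] with R hR hR0
  have hrect := Complex.integral_boundary_rect_eq_zero_of_differentiableOn q (-R : ℂ) (R + R * I)
    (hq.mono ?_)
  · simp only [neg_re, ofReal_re, neg_im, ofReal_im, neg_zero, add_re, mul_re, I_re, mul_zero, I_im,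
      zero_mul, sub_self, add_zero, add_im, mul_im, mul_one, zero_add, ofReal_zero,
      smul_eq_mul] at hrect
    have bound : ∀ w : ℂ, 0 ≤ w.im → R ≤ ‖w‖ → ‖q w‖ ≤ C / R ^ 2 := by
      intro w hw hRw
      refine (hb w hw (hR.trans hRw)).trans ?_
      gcongr
    have h1 : ‖∫ x in (-R)..R, q (x + R * I)‖ ≤ C / R ^ 2 * |R - -R| := by
      refine intervalIntegral.norm_integral_le_of_norm_le_const fun x _ => bound _ ?_ ?_
      · simpa using hR0.le
      · simpa [abs_of_pos hR0] using Complex.abs_im_le_norm ((x : ℂ) + R * I)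
    have h2 : ‖∫ y in (0 : ℝ)..R, q (R + y * I)‖ ≤ C / R ^ 2 * |R - 0| := by
      refine intervalIntegral.norm_integral_le_of_norm_le_const fun y hy => bound _ ?_ ?_
      · rw [Set.uIoc_of_le hR0.le] at hy
        simpa using hy.1.le
      · simpa [abs_of_pos hR0] using Complex.abs_re_le_norm ((R : ℂ) + y * I)
    have h3 : ‖∫ y in (0 : ℝ)..R, q (-R + y * I)‖ ≤ C / R ^ 2 * |R - 0| := by
      refine intervalIntegral.norm_integral_le_of_norm_le_const fun y hy => bound _ ?_ ?_
      · rw [Set.uIoc_of_le hR0.le] at hy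
        simpa using hy.1.le
      · simpa [abs_of_pos hR0] using Complex.abs_re_le_norm (-(R : ℂ) + y * I)
    push_cast at hrect
    have heq : ∫ x in (-R)..R, q x = (∫ x in (-R)..R, q (x + R * I)) -
        I * (∫ y in (0 : ℝ)..R, q (R + y * I)) + I * ∫ y in (0 : ℝ)..R, q (-R + y * I) := by
      linear_combination hrect
    simp only [id]
    rw [heq]
    refine (norm_add_le _ _).trans ((add_le_add_left (norm_sub_le _ _) _).trans ?_)
    rw [norm_mul, norm_mul, norm_I, one_mul, one_mul]
    have e : 4 * C / R = C / R ^ 2 * (2 * R) + C / R ^ 2 * R + C / R ^ 2 * R := by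
      field_simp; ring
    rw [e]
    rw [sub_zero, abs_of_pos hR0] at h2 h3
    rw [show R - -R = 2 * R by ring, abs_of_pos (by positivity)] at h1
    linarith
  · intro w hw
    have := (Complex.mem_reProdIm.1 hw).2
    simp only [neg_im, ofReal_im, neg_zero, add_im, mul_im, ofReal_re, I_im, mul_one, I_re,
      mul_zero, add_zero, zero_add] at this
    rw [Set.uIcc_of_le hR0.le] at this
    simp only [Set.mem_ofPred_eq]
    linarith [this.1]

lemma one_add_norm_le_mul_norm_sub {w ζ : ℂ} {η : ℝ} (hη : 0 < η) (h : η ≤ ‖w - ζ‖) :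
    1 + ‖w‖ ≤ ((1 + ‖ζ‖) / η + 1) * ‖w - ζ‖ := by
  have h1 : ‖w‖ ≤ ‖w - ζ‖ + ‖ζ‖ := by simpa using norm_add_le (w - ζ) ζ
  have h2 : 1 + ‖ζ‖ ≤ (1 + ‖ζ‖) / η * ‖w - ζ‖ := by
    rw [div_mul_eq_mul_div, le_div_iff₀ hη]
    gcongr
  linarith

lemma one_add_sq_le_one_add_abs_sq (t : ℝ) : 1 + t ^ 2 ≤ (1 + |t|) ^ 2 := by
  nlinarith [abs_nonneg t, sq_abs t]

open MeasureTheory in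
lemma integrable_div_sub {f : ℝ → ℂ} (hf : Continuous f) {C : ℝ}
    (hb : ∀ t, ‖f t‖ ≤ C / (1 + |t|)) {z : ℂ} (hz : z.im ≠ 0) :
    Integrable fun t : ℝ => f t / ((t : ℂ) - z) := by
  have him : ∀ t : ℝ, |z.im| ≤ ‖(t : ℂ) - z‖ := fun t => by
    simpa using Complex.abs_im_le_norm ((t : ℂ) - z)
  have hz' : 0 < |z.im| := abs_pos.2 hz
  set K := (1 + ‖z‖) / |z.im| + 1 with hK
  have hK0 : 0 < K := by positivity
  refine Integrable.mono' (g := fun t : ℝ => C * K * (1 + t ^ 2)⁻¹)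
    (integrable_inv_one_add_sq.const_mul _) ?_ (Eventually.of_forall fun t => ?_)
  · refine (hf.div (by fun_prop) fun t h => ?_).aestronglyMeasurable
    have := him t
    rw [h, norm_zero] at this
    linarith
  · have h1 := one_add_norm_le_mul_norm_sub hz' (him t)
    rw [norm_real, Real.norm_eq_abs] at h1
    have hpos : 0 < ‖(t : ℂ) - z‖ := hz'.trans_le (him t)
    have hC : 0 ≤ C := by
      have := (norm_nonneg _).trans (hb t)
      rwa [le_div_iff₀ (by positivity), zero_mul] at this
    rw [norm_div, div_le_iff₀ hpos]
    refine (hb t).trans ?_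
    rw [div_le_iff₀ (by positivity)]
    have h2 := one_add_sq_le_one_add_abs_sq t
    calc C = C * ((1 + t ^ 2)⁻¹ * (1 + t ^ 2)) := by field_simp
      _ ≤ C * ((1 + t ^ 2)⁻¹ * ((1 + |t|) * (K * ‖(t : ℂ) - z‖))) := by
        gcongr
        refine h2.trans ?_
        rw [sq]
        gcongr
      _ = _ := by ring

lemma inv_sub_mul_sub_conj {z : ℂ} (hz : 0 < z.im) (t : ℝ) :
    (((t : ℂ) - z) * ((t : ℂ) - conj z))⁻¹ = ((Real.pi / z.im *
      ProbabilityTheory.cauchyPDFReal z.re z.im.toNNReal t : ℝ) : ℂ) := by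
  have h : ((t : ℂ) - z) * ((t : ℂ) - conj z) = (((t - z.re) ^ 2 + z.im ^ 2 : ℝ) : ℂ) := by
    apply Complex.ext
    · simp only [ofReal_re, ofReal_im, mul_re, sub_re, sub_im, conj_re, conj_im]
      ring
    · simp only [ofReal_re, ofReal_im, mul_im, sub_re, sub_im, conj_re, conj_im]
      ring
  have hpi : (Real.pi : ℂ) ≠ 0 := by exact_mod_cast Real.pi_ne_zero
  have him : (z.im : ℂ) ≠ 0 := by exact_mod_cast hz.ne'
  rw [h, ProbabilityTheory.cauchyPDFReal, Real.coe_toNNReal _ hz.le]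
  push_cast
  field_simp

open MeasureTheory in
lemma integrable_poisson {z : ℂ} (hz : 0 < z.im) :
    Integrable fun t : ℝ => (((t : ℂ) - z) * ((t : ℂ) - conj z))⁻¹ := by
  simp_rw [inv_sub_mul_sub_conj hz]
  exact ((ProbabilityTheory.integrable_cauchyPDFReal z.re).const_mul _).ofReal

open MeasureTheory in
lemma integral_poisson {z : ℂ} (hz : 0 < z.im) :
    ∫ t : ℝ, (((t : ℂ) - z) * ((t : ℂ) - conj z))⁻¹ = Real.pi / z.im := by
  simp_rw [inv_sub_mul_sub_conj hz]
  rw [integral_complex_ofReal, integral_const_mul, ProbabilityTheory.integral_cauchyPDFReal_eq_one z.re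
    (Real.toNNReal_pos.2 hz).ne']
  push_cast
  simp

open MeasureTheory in
/-- A function holomorphic near the closed upper half plane and decaying like `1 / |w|` is
recovered from the imaginary part of its values on the real line. -/
lemma integral_im_div_sub {f : ℂ → ℂ} {ε : ℝ} (hε : 0 < ε)
    (hf : DifferentiableOn ℂ f {w | -ε < w.im}) {C : ℝ}
    (hb : ∀ w : ℂ, 0 ≤ w.im → ‖f w‖ ≤ C / (1 + ‖w‖)) {z : ℂ} (hz : 0 < z.im) :
    ∫ t : ℝ, ((f t).im : ℂ) / ((t : ℂ) - z) = Real.pi * f z := by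
  have hC : 0 ≤ C := by
    have := (norm_nonneg _).trans (hb 0 (by simp))
    simpa using this
  have hopen : IsOpen {w : ℂ | -ε < w.im} := isOpen_lt continuous_const Complex.continuous_im
  have hfc : Continuous fun t : ℝ => f t := by
    refine hf.continuousOn.comp_continuous Complex.continuous_ofReal fun t => ?_
    simpa using hε
  have hfb : ∀ t : ℝ, ‖f t‖ ≤ C / (1 + |t|) := fun t => by simpa using hb t (by simp)
  have hzc : (conj z).im ≠ 0 := by simpa using hz.ne'
  have hi1 := integrable_div_sub hfc hfb hz.ne'
  have hi2 := integrable_div_sub hfc hfb hzc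
  have hne1 : ∀ t : ℝ, (t : ℂ) - z ≠ 0 := fun t h => hz.ne' (by simpa using congrArg Complex.im h)
  have hne2 : ∀ t : ℝ, (t : ℂ) - conj z ≠ 0 := fun t h =>
    hz.ne' (by simpa using congrArg Complex.im h)
  set ε' := min ε z.im with hε'
  have hε'0 : 0 < ε' := lt_min hε hz
  have hsub : {w : ℂ | -ε' < w.im} ⊆ {w : ℂ | -ε < w.im} := fun w hw => by
    simp only [Set.mem_ofPred_eq] at hw ⊢
    linarith [min_le_left ε z.im]
  have hne : ∀ w ∈ {w : ℂ | -ε' < w.im}, w - conj z ≠ 0 := fun w hw h => by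
    have h' := congrArg Complex.im h
    simp only [Set.mem_ofPred_eq] at hw
    simp only [sub_im, conj_im, sub_neg_eq_add, zero_im] at h'
    linarith [min_le_right ε z.im]
  have him : ∀ w : ℂ, 0 ≤ w.im → z.im ≤ ‖w - conj z‖ := fun w hw => by
    have := Complex.im_le_norm (w - conj z)
    simp only [sub_im, conj_im, sub_neg_eq_add] at this
    linarith
  set K := (1 + ‖conj z‖) / z.im + 1 with hK
  have hK0 : 0 < K := by positivity
  have hKw : ∀ w : ℂ, 0 ≤ w.im → 1 + ‖w‖ ≤ K * ‖w - conj z‖ := fun w hw =>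
    one_add_norm_le_mul_norm_sub hz (him w hw)
  have hlow : ∫ t : ℝ, f t / ((t : ℂ) - conj z) = 0 := by
    refine integral_eq_zero_of_decay (q := fun w => f w / (w - conj z)) hε'0
      ((hf.mono hsub).div (by fun_prop) hne) hi2 (C := C * K) (R₀ := 1) (by positivity) ?_
    intro w hw hw1
    have hpos : 0 < ‖w - conj z‖ := hz.trans_le (him w hw)
    have hw0 : 0 < ‖w‖ := by linarith
    rw [norm_div, div_le_div_iff₀ hpos (by positivity)]
    have h1 := hb w hw
    rw [le_div_iff₀ (by positivity)] at h1
    have h2 := hKw w hw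
    calc ‖f w‖ * ‖w‖ ^ 2 = ‖f w‖ * ‖w‖ * ‖w‖ := by ring
      _ ≤ ‖f w‖ * (1 + ‖w‖) * (1 + ‖w‖) := by gcongr <;> linarith
      _ ≤ C * (K * ‖w - conj z‖) := by gcongr
      _ = _ := by ring
  have hi3 : Integrable fun t : ℝ => f t * (((t : ℂ) - z) * ((t : ℂ) - conj z))⁻¹ := by
    refine (hi1.sub hi2).const_mul ((z - conj z)⁻¹) |>.congr (Eventually.of_forall fun t => ?_)
    have h3 : z - conj z ≠ 0 := fun h => by
      have := congrArg Complex.im h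
      simp only [sub_im, conj_im, sub_neg_eq_add, zero_im] at this
      linarith
    have := hne1 t
    have := hne2 t
    simp only [Pi.sub_apply]
    field_simp
    ring
  have hsplit : ∀ t : ℝ, (f t - f z) * (((t : ℂ) - z) * ((t : ℂ) - conj z))⁻¹ =
      f t * (((t : ℂ) - z) * ((t : ℂ) - conj z))⁻¹ -
        f z * (((t : ℂ) - z) * ((t : ℂ) - conj z))⁻¹ := fun t => sub_mul _ _ _
  have hmain : ∫ t : ℝ, (f t - f z) * (((t : ℂ) - z) * ((t : ℂ) - conj z))⁻¹ = 0 := by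
    have hz' : {w : ℂ | -ε < w.im} ∈ 𝓝 z :=
      hopen.mem_nhds (by simp only [Set.mem_ofPred_eq]; linarith)
    have hds := (Complex.differentiableOn_dslope hz').2 hf
    have heq : ∀ w : ℂ, w ≠ z → dslope f z w / (w - conj z) =
        (f w - f z) * ((w - z) * (w - conj z))⁻¹ := by
      intro w hw
      rw [dslope_of_ne _ hw, slope_def_field, mul_inv, ← mul_assoc, div_eq_mul_inv,
        div_eq_mul_inv]
    have heqt : ∀ t : ℝ, (f t - f z) * (((t : ℂ) - z) * ((t : ℂ) - conj z))⁻¹ =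
        dslope f z t / ((t : ℂ) - conj z) := fun t => (heq t (sub_ne_zero.1 (hne1 t))).symm
    simp_rw [heqt]
    refine integral_eq_zero_of_decay (q := fun w => dslope f z w / (w - conj z)) hε'0
      ((hds.mono hsub).div (by fun_prop) hne) ?_ (C := (C + ‖f z‖) * 2 * K)
      (R₀ := 2 * ‖z‖ + 1) (by positivity) ?_
    · simp_rw [← heqt, hsplit]
      exact hi3.sub ((integrable_poisson hz).const_mul _)
    · intro w hw hw1
      have hwz : w ≠ z := by
        rintro rfl
        linarith [norm_nonneg w]
      have hwz' : ‖w‖ ≤ 2 * ‖w - z‖ := by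
        have : ‖w‖ ≤ ‖w - z‖ + ‖z‖ := by simpa using norm_add_le (w - z) z
        linarith
      have hw0 : 0 < ‖w‖ := by linarith [norm_nonneg z]
      have hp1 : 0 < ‖w - z‖ := by linarith
      have hpos : 0 < ‖w - conj z‖ := hz.trans_le (him w hw)
      have h1 : ‖f w - f z‖ ≤ C + ‖f z‖ := by
        refine (norm_sub_le _ _).trans (add_le_add_left ((hb w hw).trans ?_) _)
        exact div_le_self hC (by linarith)
      rw [heq w hwz, norm_mul, norm_inv, norm_mul, ← div_eq_mul_inv,
        div_le_div_iff₀ (by positivity) (by positivity)]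
      have h2 := hKw w hw
      calc ‖f w - f z‖ * ‖w‖ ^ 2 ≤ (C + ‖f z‖) * (‖w‖ * ‖w‖) := by rw [sq]; gcongr
        _ ≤ (C + ‖f z‖) * ((2 * ‖w - z‖) * (K * ‖w - conj z‖)) := by
          gcongr; linarith
        _ = _ := by ring
  have hval : ∫ t : ℝ, f t * (((t : ℂ) - z) * ((t : ℂ) - conj z))⁻¹ =
      f z * (Real.pi / z.im) := by
    simp_rw [hsplit] at hmain
    rw [integral_sub hi3 ((integrable_poisson hz).const_mul _), integral_const_mul,
      integral_poisson hz] at hmain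
    linear_combination hmain
  have hup : ∫ t : ℝ, f t / ((t : ℂ) - z) = 2 * I * Real.pi * f z := by
    have e : ∀ t : ℝ, f t / ((t : ℂ) - z) = f t / ((t : ℂ) - conj z) +
        (z - conj z) * (f t * (((t : ℂ) - z) * ((t : ℂ) - conj z))⁻¹) := by
      intro t
      have := hne1 t
      have := hne2 t
      field_simp
      ring
    simp_rw [e]
    rw [integral_add hi2 (hi3.const_mul _), integral_const_mul, hlow, hval, Complex.sub_conj]
    have : (z.im : ℂ) ≠ 0 := by exact_mod_cast hz.ne'
    push_cast
    field_simp
    ring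
  have hconj : ∫ t : ℝ, conj (f t / ((t : ℂ) - conj z)) = 0 := by
    rw [integral_conj, hlow, map_zero]
  have hfin : ∀ t : ℝ, ((f t).im : ℂ) / ((t : ℂ) - z) = (2 * I)⁻¹ * (f t / ((t : ℂ) - z) -
      conj (f t / ((t : ℂ) - conj z))) := by
    intro t
    have := hne1 t
    have h2 : ((f t).im : ℂ) = (2 * I)⁻¹ * (f t - conj (f t)) := by
      rw [Complex.sub_conj]; push_cast; field_simp
    rw [h2, map_div₀, map_sub, Complex.conj_conj, Complex.conj_ofReal]
    ring
  simp_rw [hfin]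
  have hi2' : Integrable fun t : ℝ => conj (f t / ((t : ℂ) - conj z)) := by
    exact (Complex.conjCLE.toContinuousLinearMap.integrable_comp hi2)
  rw [integral_const_mul, integral_sub hi1 hi2', hup, hconj]
  field_simp
  ring

lemma re_im_logGamma_of_eq {k : ℕ} {z w : ℂ}
    (h : logGamma w = Complex.log z - ((k : ℂ) + 1) * Real.pi * I) :
    (logGamma w).re = Real.log ‖z‖ ∧ (logGamma w).im = z.arg - (k + 1) * Real.pi := by
  rw [h]
  constructor
  · simp [Complex.log_re]
  · simp [Complex.log_im]

lemma im_logGamma_mem_Icc {k : ℕ} {z w : ℂ} (hz : 0 < z.im)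
    (h : logGamma w = Complex.log z - ((k : ℂ) + 1) * Real.pi * I) :
    (logGamma w).im ∈ Set.Icc (-((k + 1) * Real.pi)) (-(k * Real.pi)) := by
  rw [(re_im_logGamma_of_eq h).2]
  have h1 := Complex.arg_le_pi z
  have h2 := Complex.arg_nonneg_iff.2 hz.le
  constructor <;> linarith

lemma re_le_two_of_logGamma_eq {k : ℕ} {z w : ℂ} (hz : 0 < z.im) (hw : 0 < w.im)
    (h : logGamma w = Complex.log z - ((k : ℂ) + 1) * Real.pi * I) : w.re ≤ 2 := by
  by_contra! hcon
  have h1 := im_logGamma_pos hw hcon.le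
  have h2 := (im_logGamma_mem_Icc hz h).2
  have : 0 ≤ (k : ℝ) * Real.pi := by positivity
  linarith

lemma ne_neg_natCast_of_im_pos {w : ℂ} (hw : 0 < w.im) (j : ℕ) : w ≠ -j := by
  rintro rfl
  simp at hw

lemma Gamma_eq_neg_of_logGamma_eq {k : ℕ} (hk : Even k) {z w : ℂ} (hz : 0 < z.im) (hw : 0 < w.im)
    (h : logGamma w = Complex.log z - ((k : ℂ) + 1) * Real.pi * I) : Complex.Gamma w = -z := by
  have hz0 : z ≠ 0 := by rintro rfl; simp at hz
  obtain ⟨m, rfl⟩ := hk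
  rw [← exp_logGamma (ne_neg_natCast_of_im_pos hw), h, Complex.exp_sub, Complex.exp_log hz0]
  have : ((m + m : ℕ) + 1 : ℂ) * Real.pi * I = Real.pi * I + m * (2 * Real.pi * I) := by
    push_cast; ring
  rw [this, Complex.exp_add, Complex.exp_pi_mul_I, Complex.exp_nat_mul_two_pi_mul_I,
    mul_one, div_neg, div_one]

lemma exists_norm_le_add_mul_abs_log (k : ℕ) : ∃ A B : ℝ, 0 ≤ A ∧ 0 ≤ B ∧ ∀ z w : ℂ, 0 < z.im →
    0 < w.im → logGamma w = Complex.log z - ((k : ℂ) + 1) * Real.pi * I →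
    ‖w‖ ≤ A + B * |Real.log ‖z‖| := by
  refine ⟨‖(2 + I : ℂ)‖ + 20 * ((k + 1) * Real.pi + ‖logGamma (2 + I)‖), 20, by positivity,
    by norm_num, fun z w hz hw h => ?_⟩
  have h1 := norm_sq_le_im_logGamma_sub hw (re_le_two_of_logGamma_eq hz hw h)
  have h2 := (Complex.im_le_norm _).trans' h1
  rw [norm_mul, Complex.norm_conj] at h2
  have h3 : ‖w - (2 + I)‖ ≤ 20 * ‖logGamma w - logGamma (2 + I)‖ := by
    rcases (norm_nonneg (w - (2 + I))).eq_or_lt with h0 | h0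
    · rw [← h0]; positivity
    · rw [sq, ← mul_assoc] at h2
      have := le_of_mul_le_mul_right h2 h0
      linarith
  have h4 := norm_sub_le (logGamma w) (logGamma (2 + I))
  have h5 := Complex.norm_le_abs_re_add_abs_im (logGamma w)
  rw [(re_im_logGamma_of_eq h).1] at h5
  have h6 : |(logGamma w).im| ≤ (k + 1) * Real.pi := by
    have h7 := im_logGamma_mem_Icc hz h
    have : 0 ≤ (k : ℝ) * Real.pi := by positivity
    exact abs_le.2 ⟨h7.1, by linarith [h7.2, Real.pi_pos]⟩
  have h8 : ‖w‖ ≤ ‖w - (2 + I)‖ + ‖(2 + I : ℂ)‖ := by simpa using norm_add_le (w - (2 + I)) (2 + I)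
  linarith

lemma exists_im_logGamma_two_add_le :
    ∃ S : ℝ, 0 ≤ S ∧ ∀ b ∈ Set.Icc (0 : ℝ) 1, (logGamma (2 + b * I)).im ≤ S := by
  have hc : ContinuousOn (fun b : ℝ => (logGamma (2 + b * I)).im) (Set.Icc 0 1) := by
    intro b hb
    have h := continuousWithinAt_logGamma (z := 2 + b * I) fun j hj => by
      have := congrArg Complex.re hj
      simp at this
      linarith [(Nat.cast_nonneg j : (0 : ℝ) ≤ j)]
    refine Complex.continuous_im.continuousAt.comp_continuousWithinAt
      (h.comp (f := fun b : ℝ => (2 + b * I : ℂ)) (by fun_prop) fun b hb => ?_)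
    simpa using hb.1
  obtain ⟨S, hS⟩ := (isCompact_Icc.image_of_continuousOn hc).bddAbove
  exact ⟨max S 0, le_max_right _ _, fun b hb => (hS ⟨b, hb, rfl⟩).trans (le_max_left _ _)⟩

lemma exists_norm_le_of_le_norm (k : ℕ) : ∃ A R : ℝ, 0 < R ∧ ∀ z w : ℂ, 0 < z.im → 0 < w.im →
    logGamma w = Complex.log z - ((k : ℂ) + 1) * Real.pi * I → R ≤ ‖z‖ → ‖w‖ ≤ A := by
  obtain ⟨S, hS0, hS⟩ := exists_im_logGamma_two_add_le
  set T := (k + 1) * Real.pi + |(logGamma (2 + I)).im| with hT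
  have hT0 : 0 ≤ T := by positivity
  set U := (S + (k + 1) * Real.pi) / (Real.pi / 4) with hU
  have hU0 : 0 ≤ U := by positivity
  refine ⟨max (20 * T + ‖(2 + I : ℂ)‖) (U + 4), Real.exp (logGamma (2 + I)).re,
    Real.exp_pos _, fun z w hz hw h hR => ?_⟩
  have hre := re_le_two_of_logGamma_eq hz hw h
  have him := im_logGamma_mem_Icc hz h
  rcases le_total 1 w.im with hb | hb
  · refine le_max_of_le_left ?_
    have h1 := norm_sq_le_im_logGamma_sub hw hre
    have hlog : (logGamma (2 + I)).re ≤ (logGamma w).re := by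
      rw [(re_im_logGamma_of_eq h).1, ← Real.log_exp (logGamma (2 + I)).re]
      exact Real.log_le_log (Real.exp_pos _) hR
    have h2 : ((logGamma w - logGamma (2 + I)) * conj (w - (2 + I))).im ≤
        T * ‖w - (2 + I)‖ := by
      have e : ((logGamma w - logGamma (2 + I)) * conj (w - (2 + I))).im =
        ((logGamma w).im - (logGamma (2 + I)).im) * (w - (2 + I)).re -
          ((logGamma w).re - (logGamma (2 + I)).re) * (w.im - 1) := by
        simp [Complex.mul_im]
        ring
      rw [e]
      have h3 : 0 ≤ ((logGamma w).re - (logGamma (2 + I)).re) * (w.im - 1) :=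
        mul_nonneg (by linarith) (by linarith)
      have h4 : ((logGamma w).im - (logGamma (2 + I)).im) * (w - (2 + I)).re ≤
          T * ‖w - (2 + I)‖ := by
        refine (le_abs_self _).trans ?_
        rw [abs_mul]
        refine mul_le_mul ?_ (Complex.abs_re_le_norm _) (abs_nonneg _) hT0
        refine (abs_sub _ _).trans (add_le_add_left (abs_le.2 ⟨him.1, ?_⟩) _)
        have : 0 ≤ (k : ℝ) * Real.pi := by positivity
        linarith [him.2, Real.pi_pos]
      linarith
    have h3 : ‖w - (2 + I)‖ ≤ 20 * T := by
      rcases (norm_nonneg (w - (2 + I))).eq_or_lt with h0 | h0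
      · rw [← h0]; positivity
      · have h5 := h1.trans h2
        rw [sq, ← mul_assoc] at h5
        have := le_of_mul_le_mul_right h5 h0
        linarith
    have h8 : ‖w‖ ≤ ‖w - (2 + I)‖ + ‖(2 + I : ℂ)‖ := by
      simpa using norm_add_le (w - (2 + I)) (2 + I)
    linarith
  · refine le_max_of_le_right ?_
    have hlow : -(U + 1) ≤ w.re := by
      by_contra! hcon
      set N := ⌊-w.re⌋₊ with hN
      have hN1 : (N : ℝ) ≤ -w.re := Nat.floor_le (by linarith)
      have hN2 : -w.re < N + 1 := Nat.lt_floor_add_one _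
      have h1 := im_logGamma_le_sub hw hb (N := N) (by linarith)
      have h2 := hS w.im ⟨hw.le, hb⟩
      have h3 : U * (Real.pi / 4) = S + (k + 1) * Real.pi := by
        rw [hU, div_mul_cancel₀ _ (by positivity)]
      have h4 : U * (Real.pi / 4) < N * (Real.pi / 4) := by
        have : U < N := by linarith
        gcongr
      linarith [him.1]
    have h1 := Complex.norm_le_abs_re_add_abs_im w
    have h2 : |w.re| ≤ U + 3 := abs_le.2 ⟨by linarith, by linarith⟩
    rw [abs_of_pos hw] at h1
    linarith

lemma exists_norm_Gamma_le (A : ℝ) : ∃ K : ℝ, ∀ w : ℂ, ‖w‖ ≤ A → (∀ j : ℕ, 1 / 4 ≤ ‖w + j‖) →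
    ‖Complex.Gamma w‖ ≤ K := by
  have hcl : IsClosed (⋂ j : ℕ, {w : ℂ | 1 / 4 ≤ ‖w + j‖}) :=
    isClosed_iInter fun j => isClosed_le continuous_const (by fun_prop)
  have hcomp := (isCompact_closedBall (0 : ℂ) A).inter_right hcl
  have hcont : ContinuousOn Complex.Gamma
      (Metric.closedBall (0 : ℂ) A ∩ ⋂ j : ℕ, {w : ℂ | 1 / 4 ≤ ‖w + j‖}) := by
    intro w hw
    refine (Complex.differentiableAt_Gamma w fun j hj => ?_).continuousAt.continuousWithinAt
    have := Set.mem_iInter.1 hw.2 j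
    simp only [Set.mem_ofPred_eq, hj, neg_add_cancel, norm_zero] at this
    norm_num at this
  obtain ⟨K, hK⟩ := hcomp.exists_bound_of_continuousOn hcont
  exact ⟨K, fun w hw hj => hK w ⟨by simpa using hw, Set.mem_iInter.2 hj⟩⟩

lemma exists_norm_Gamma_mul_add_le (j : ℕ) : ∃ C : ℝ, ∀ w : ℂ, ‖w + j‖ < 1 / 4 → w ≠ -j →
    ‖Complex.Gamma w * (w + j)‖ ≤ C := by
  induction j with
  | zero =>
    have hcont : ContinuousOn Complex.Gamma (Metric.closedBall (1 : ℂ) (1 / 4)) := by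
      intro w hw
      refine (Complex.differentiableAt_Gamma w fun j hj => ?_).continuousAt.continuousWithinAt
      rw [mem_closedBall_iff_norm, hj] at hw
      have h1 := (Complex.abs_re_le_norm _).trans hw
      simp only [sub_re, neg_re, natCast_re, one_re] at h1
      have := (abs_le.1 h1).1
      linarith [(Nat.cast_nonneg j : (0 : ℝ) ≤ j)]
    obtain ⟨C, hC⟩ := (isCompact_closedBall (1 : ℂ) (1 / 4)).exists_bound_of_continuousOn hcont
    refine ⟨C, fun w hw hw0 => ?_⟩
    simp only [Nat.cast_zero, add_zero, neg_zero] at hw hw0 ⊢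
    rw [mul_comm, ← Complex.Gamma_add_one w hw0]
    refine hC _ ?_
    rw [mem_closedBall_iff_norm, add_sub_cancel_right]
    exact hw.le
  | succ j ih =>
    obtain ⟨C, hC⟩ := ih
    refine ⟨C * (4 / 3), fun w hw hne => ?_⟩
    push_cast at hw hne ⊢
    have hnorm : 3 / 4 ≤ ‖w‖ := by
      have h1 : ‖(j : ℂ) + 1‖ ≤ ‖w + (j + 1)‖ + ‖w‖ := by
        simpa using norm_sub_le (w + (j + 1)) w
      have h2 : (1 : ℝ) ≤ ‖(j : ℂ) + 1‖ := by
        have := Complex.re_le_norm ((j : ℂ) + 1)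
        simp only [add_re, natCast_re, one_re] at this
        linarith [(Nat.cast_nonneg j : (0 : ℝ) ≤ j)]
      linarith
    have hw0 : w ≠ 0 := by
      rintro rfl
      norm_num at hnorm
    have h1 := hC (w + 1) (by rwa [add_assoc, add_comm (1 : ℂ)]) fun h => hne (by
      linear_combination h)
    rw [Complex.Gamma_add_one w hw0] at h1
    have h2 : w * Complex.Gamma w * (w + 1 + j) = w * (Complex.Gamma w * (w + (j + 1))) := by ring
    rw [h2, norm_mul] at h1
    have h3 : 3 / 4 * ‖Complex.Gamma w * (w + (j + 1))‖ ≤ C := h1.trans' (by gcongr)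
    linarith

lemma isPreconnected_im_pos_lt_norm {R : ℝ} (hR : 0 < R) :
    IsPreconnected {z : ℂ | 0 < z.im ∧ R < ‖z‖} := by
  have hconv : Convex ℝ ({w : ℂ | Real.log R < w.re} ∩ {w : ℂ | 0 < w.im} ∩
      {w : ℂ | w.im < Real.pi}) :=
    ((convex_halfSpace_re_gt _).inter (convex_halfSpace_im_gt _)).inter (convex_halfSpace_im_lt _)
  convert hconv.isPreconnected.image Complex.exp Complex.continuous_exp.continuousOn using 1
  ext z
  constructor
  · rintro ⟨hz, hzR⟩
    have hz0 : z ≠ 0 := by rintro rfl; simp at hz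
    refine ⟨Complex.log z, ⟨⟨?_, ?_⟩, ?_⟩, Complex.exp_log hz0⟩
    · simp only [Set.mem_ofPred_eq, Complex.log_re]
      exact Real.log_lt_log hR hzR
    · simp only [Set.mem_ofPred_eq, Complex.log_im]
      refine (Complex.arg_nonneg_iff.2 hz.le).lt_of_ne fun h => hz.ne' ?_
      exact (Complex.arg_eq_zero_iff.1 h.symm).2
    · simp only [Set.mem_ofPred_eq, Complex.log_im]
      exact (Complex.arg_le_pi z).lt_of_ne fun h => hz.ne' (Complex.arg_eq_pi_iff.1 h).2
  · rintro ⟨w, ⟨⟨h1, h2⟩, h3⟩, rfl⟩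
    simp only [Set.mem_ofPred_eq] at h1 h2 h3 ⊢
    rw [Complex.exp_im, Complex.norm_exp]
    refine ⟨mul_pos (Real.exp_pos _) (Real.sin_pos_of_pos_of_lt_pi h2 h3), ?_⟩
    rwa [← Real.log_lt_iff_lt_exp hR]

lemma eq_of_norm_add_natCast_lt {w : ℂ} {i j : ℕ} (hi : ‖w + i‖ < 1 / 4) (hj : ‖w + j‖ < 1 / 4) :
    i = j := by
  have h1 : ‖(i : ℂ) - j‖ < 1 := by
    have := norm_sub_le (w + i) (w + j)
    rw [add_sub_add_left_eq_sub] at this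
    linarith
  have h2 : |((i - j : ℤ) : ℝ)| < 1 := by
    have := (Complex.abs_re_le_norm _).trans_lt h1
    simpa using this
  have h3 : |(i - j : ℤ)| < 1 := by exact_mod_cast h2
  rw [Int.abs_lt_one_iff] at h3
  omega

lemma exists_forall_norm_add_lt {k : ℕ} (hk : Even k) {g : ℂ → ℂ}
    (hg : DifferentiableOn ℂ g {z : ℂ | 0 < z.im}) (hgim : ∀ z : ℂ, 0 < z.im → 0 < (g z).im)
    (hgL : ∀ z : ℂ, 0 < z.im → logGamma (g z) = Complex.log z - ((k : ℂ) + 1) * Real.pi * I) :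
    ∃ j : ℕ, ∃ R : ℝ, 0 < R ∧ ∀ z : ℂ, 0 < z.im → R < ‖z‖ → ‖g z + j‖ < 1 / 4 := by
  obtain ⟨A, R₁, hR₁, hA⟩ := exists_norm_le_of_le_norm k
  obtain ⟨K, hK⟩ := exists_norm_Gamma_le A
  set R := max R₁ K with hR
  have hR0 : 0 < R := hR₁.trans_le (le_max_left _ _)
  set U : Set ℂ := {z : ℂ | 0 < z.im ∧ R < ‖z‖} with hU
  have hex : ∀ z ∈ U, ∃ j : ℕ, ‖g z + j‖ < 1 / 4 := by
    rintro z ⟨hz, hzR⟩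
    by_contra! hcon
    have h1 := hK (g z) (hA z (g z) hz (hgim z hz) (hgL z hz)
      ((le_max_left _ _).trans hzR.le)) hcon
    rw [Gamma_eq_neg_of_logGamma_eq hk hz (hgim z hz) (hgL z hz), norm_neg] at h1
    exact (((le_max_right _ _).trans_lt hzR).trans_le h1).false
  have hz0 : (((R + 1 : ℝ) : ℂ) * I) ∈ U := by
    refine ⟨by simpa using by linarith, ?_⟩
    rw [norm_mul, norm_I, mul_one, norm_real, Real.norm_eq_abs, abs_of_pos (by linarith)]
    linarith
  obtain ⟨j, hj⟩ := hex _ hz0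
  refine ⟨j, R, hR0, fun z hz hzR => ?_⟩
  have hpre : IsPreconnected (g '' U) :=
    (isPreconnected_im_pos_lt_norm hR0).image g (hg.continuousOn.mono fun z hz => hz.1)
  have hopen : ∀ i : ℕ, IsOpen {w : ℂ | ‖w + i‖ < 1 / 4} := fun i =>
    isOpen_lt (by fun_prop) continuous_const
  have hne : (g '' U ∩ {w : ℂ | ‖w + j‖ < 1 / 4}).Nonempty := ⟨_, ⟨_, hz0, rfl⟩, hj⟩
  have hsub := hpre.subset_left_of_subset_union (u := {w : ℂ | ‖w + j‖ < 1 / 4})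
    (v := ⋃ i : ℕ, ⋃ _ : i ≠ j, {w : ℂ | ‖w + i‖ < 1 / 4}) (hopen j)
    (isOpen_iUnion fun i => isOpen_iUnion fun _ => hopen i) ?_ ?_ hne
  · exact hsub ⟨z, ⟨hz, hzR⟩, rfl⟩
  · rw [Set.disjoint_left]
    intro w hw hw'
    simp only [Set.mem_iUnion, Set.mem_ofPred_eq, exists_prop] at hw hw'
    obtain ⟨i, hij, hi⟩ := hw'
    exact hij (eq_of_norm_add_natCast_lt hi hw)
  · rintro _ ⟨z, hz, rfl⟩
    obtain ⟨i, hi⟩ := hex z hz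
    by_cases hij : i = j
    · subst hij
      exact Or.inl hi
    · exact Or.inr (Set.mem_iUnion₂.2 ⟨i, hij, hi⟩)

lemma tendsto_im_logGamma_ofReal_add {ι : Type*} {l : Filter ι} {b : ι → ℝ} (hb : ∀ i, 0 ≤ b i)
    (hl : Tendsto b l (𝓝 0)) {x : ℝ} {k : ℕ} (hneg : ∀ j < k, x + (j : ℝ) < 0)
    (hpos : 0 < x + k) :
    Tendsto (fun i => (logGamma (x + b i * I)).im) l (𝓝 (-(k * Real.pi))) := by
  rw [← im_logGamma_ofReal hneg hpos]
  have h1 : Tendsto (fun i => (x + b i * I : ℂ)) l (𝓝[{z | 0 ≤ z.im}] (x : ℂ)) := by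
    refine tendsto_nhdsWithin_iff.2 ⟨?_, Eventually.of_forall fun i => by simpa using hb i⟩
    have : Tendsto (fun i => (x + b i * I : ℂ)) l (𝓝 (x + (0 : ℝ) * I)) :=
      (((Complex.continuous_ofReal.tendsto 0).comp hl).mul_const I).const_add _
    simpa using this
  exact (Complex.continuous_im.tendsto _).comp
    ((continuousWithinAt_logGamma (ofReal_ne_neg_natCast hneg hpos)).tendsto.comp h1)

lemma exists_norm_add_natCast_le_div {k : ℕ} (hk : Even k) {g : ℂ → ℂ}
    (hg : DifferentiableOn ℂ g {z : ℂ | 0 < z.im}) (hgim : ∀ z : ℂ, 0 < z.im → 0 < (g z).im)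
    (hgL : ∀ z : ℂ, 0 < z.im → logGamma (g z) = Complex.log z - ((k : ℂ) + 1) * Real.pi * I) :
    ∃ C R : ℝ, 0 < R ∧ ∀ z : ℂ, 0 < z.im → R < ‖z‖ → ‖g z + k‖ ≤ C / ‖z‖ := by
  obtain ⟨j, R, hR, hj⟩ := exists_forall_norm_add_lt hk hg hgim hgL
  obtain ⟨C, hC⟩ := exists_norm_Gamma_mul_add_le j
  have hdecay : ∀ z : ℂ, 0 < z.im → R < ‖z‖ → ‖g z + j‖ ≤ C / ‖z‖ := by
    intro z hz hzR
    have h1 := hC (g z) (hj z hz hzR) (ne_neg_natCast_of_im_pos (hgim z hz) j)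
    rw [Gamma_eq_neg_of_logGamma_eq hk hz (hgim z hz) (hgL z hz), norm_mul, norm_neg] at h1
    rwa [le_div_iff₀ (hR.trans hzR), mul_comm]
  suffices j = k by subst this; exact ⟨C, R, hR, hdecay⟩
  set ζ : ℕ → ℂ := fun n => ((R + 1 + n : ℝ) : ℂ) * I with hζ
  have hζpos : ∀ n : ℕ, 0 < R + 1 + (n : ℝ) := fun n => by positivity
  have hζim : ∀ n, 0 < (ζ n).im := fun n => by simpa [hζ] using hζpos n
  have hζnorm : ∀ n, ‖ζ n‖ = R + 1 + n := fun n => by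
    rw [hζ, norm_mul, norm_I, mul_one, norm_real, Real.norm_eq_abs, abs_of_pos (hζpos n)]
  have hζR : ∀ n, R < ‖ζ n‖ := fun n => by
    rw [hζnorm]
    linarith [(Nat.cast_nonneg n : (0 : ℝ) ≤ n)]
  have hζarg : ∀ n, (ζ n).arg = Real.pi / 2 := fun n => by
    rw [hζ, Complex.arg_real_mul _ (hζpos n), Complex.arg_I]
  have hL : ∀ n, (logGamma (g (ζ n))).im = Real.pi / 2 - (k + 1) * Real.pi := fun n => by
    rw [(re_im_logGamma_of_eq (hgL _ (hζim n))).2, hζarg]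
  have hb : Tendsto (fun n => (g (ζ n)).im) atTop (𝓝 0) := by
    have hlim : Tendsto (fun n : ℕ => C / (R + 1 + n)) atTop (𝓝 0) :=
      tendsto_const_nhds.div_atTop (tendsto_const_nhds.add_atTop tendsto_natCast_atTop_atTop)
    refine squeeze_zero (fun n => (hgim _ (hζim n)).le) (fun n => ?_) hlim
    have h1 := hdecay _ (hζim n) (hζR n)
    have h2 := Complex.im_le_norm (g (ζ n) + j)
    rw [hζnorm] at h1
    simp only [add_im, natCast_im, add_zero] at h2
    linarith
  have hre : ∀ n, |(g (ζ n)).re + j| < 1 / 4 := fun n => by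
    simpa using (Complex.abs_re_le_norm _).trans_lt (hj _ (hζim n) (hζR n))
  have hup := tendsto_im_logGamma_ofReal_add (fun n => (hgim _ (hζim n)).le) hb
    (x := -j + 1 / 2) (k := j) (fun i hi => by
      have : (i : ℝ) + 1 ≤ j := by exact_mod_cast hi
      linarith) (by linarith)
  have hlow := tendsto_im_logGamma_ofReal_add (fun n => (hgim _ (hζim n)).le) hb
    (x := -j - 1 / 2) (k := j + 1) (fun i hi => by
      have : (i : ℝ) + 1 ≤ j + 1 := by exact_mod_cast hi
      linarith) (by push_cast; linarith)
  have h1 := ge_of_tendsto' hup (b := Real.pi / 2 - (k + 1) * Real.pi) fun n => by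
    rw [← hL n]
    refine im_logGamma_mono (hgim _ (hζim n)) (by simp) ?_
    simp only [add_re, ofReal_re, mul_re, I_re, mul_zero, ofReal_im, I_im, mul_one, sub_self,
      add_zero]
    linarith [(abs_lt.1 (hre n)).2]
  have h2 := le_of_tendsto' hlow (b := Real.pi / 2 - (k + 1) * Real.pi) fun n => by
    rw [← hL n]
    refine im_logGamma_mono (by simpa using hgim _ (hζim n)) (by simp) ?_
    simp only [add_re, ofReal_re, mul_re, I_re, mul_zero, ofReal_im, I_im, mul_one, sub_self,
      add_zero]
    linarith [(abs_lt.1 (hre n)).1]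
  push_cast at h2
  have hpi := Real.pi_pos
  have h3 : (j : ℝ) < k + 1 := by nlinarith
  have h4 : (k : ℝ) < j + 1 := by nlinarith
  have h5 : j < k + 1 := by exact_mod_cast h3
  have h6 : k < j + 1 := by exact_mod_cast h4
  omega

lemma tendsto_im_zero_of_tendsto_logGamma {ι : Type*} {l : Filter ι} {w : ι → ℂ} {M x : ℝ}
    (hw : ∀ᶠ i in l, 0 < (w i).im ∧ ‖w i‖ ≤ M) (hx : ∀ j : ℕ, (x : ℂ) ≠ -j)
    (hL : Tendsto (fun i => logGamma (w i)) l (𝓝 (logGamma x))) :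
    Tendsto (fun i => (w i).im) l (𝓝 0) := by
  set M' := max M (|x| + 1) with hM'
  have hM0 : 0 < M' := by
    have : |x| + 1 ≤ M' := le_max_right _ _
    linarith [abs_nonneg x]
  have h1 : Tendsto (fun i => √(2 * M' ^ 2 * ‖logGamma (w i) - logGamma x‖)) l (𝓝 0) := by
    have h2 := (tendsto_iff_norm_sub_tendsto_zero.1 hL).const_mul (2 * M' ^ 2)
    rw [mul_zero] at h2
    have h3 := (Real.continuous_sqrt.tendsto 0).comp h2
    rwa [Real.sqrt_zero] at h3
  refine squeeze_zero' (hw.mono fun i hi => hi.1.le) (hw.mono fun i hi => ?_) h1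
  refine Real.le_sqrt_of_sq_le ?_
  have h3 := im_sq_le_norm_logGamma_sub hi.1 hx (hi.2.trans (le_max_left _ _))
    (le_max_right M (|x| + 1))
  rw [div_mul_eq_mul_div, div_le_iff₀ (by positivity)] at h3
  linarith

lemma tendsto_im_zero_of_Gamma_eq {k : ℕ} {g : ℂ → ℂ} (hgim : ∀ z : ℂ, 0 < z.im → 0 < (g z).im)
    (hgL : ∀ z : ℂ, 0 < z.im → logGamma (g z) = Complex.log z - ((k : ℂ) + 1) * Real.pi * I)
    {t x : ℝ} (ht : t ≠ 0) (hx : ∀ j : ℕ, (x : ℂ) ≠ -j)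
    (hL : logGamma x = Complex.log t - ((k : ℂ) + 1) * Real.pi * I) :
    Tendsto (fun y : ℝ => (g (t + y * I)).im) (𝓝[>] 0) (𝓝 0) := by
  have hζ : Tendsto (fun y : ℝ => (t + y * I : ℂ)) (𝓝[>] 0) (𝓝[{z | 0 ≤ z.im}] (t : ℂ)) := by
    refine tendsto_nhdsWithin_iff.2 ⟨?_, ?_⟩
    · have : Continuous fun y : ℝ => (t + y * I : ℂ) := by fun_prop
      simpa using (this.tendsto 0).mono_left nhdsWithin_le_nhds
    · filter_upwards [self_mem_nhdsWithin] with y hy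
      simpa using (Set.mem_Ioi.1 hy).le
  have ht' : (t : ℂ) ≠ 0 := by exact_mod_cast ht
  have him : ∀ y : ℝ, y ∈ Set.Ioi (0 : ℝ) → 0 < (t + y * I : ℂ).im := fun y hy => by simpa using hy
  obtain ⟨A, B, -, hB, hAB⟩ := exists_norm_le_add_mul_abs_log k
  have hlogn : Tendsto (fun y : ℝ => A + B * |Real.log ‖(t + y * I : ℂ)‖|) (𝓝[>] 0)
      (𝓝 (A + B * |Real.log ‖(t : ℂ)‖|)) := by
    have h1 : Tendsto (fun y : ℝ => ‖(t + y * I : ℂ)‖) (𝓝[>] 0) (𝓝 ‖(t : ℂ)‖) :=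
      (continuous_norm.tendsto _).comp (hζ.mono_right nhdsWithin_le_nhds)
    exact (((Real.continuousAt_log (norm_ne_zero_iff.2 ht')).tendsto.comp h1).abs.const_mul
      B).const_add A
  refine tendsto_im_zero_of_tendsto_logGamma (M := A + B * |Real.log ‖(t : ℂ)‖| + 1) ?_ hx ?_
  · filter_upwards [self_mem_nhdsWithin, hlogn.eventually_le_const (lt_add_one _)] with y hy h1
    exact ⟨hgim _ (him y hy), (hAB _ _ (him y hy) (hgim _ (him y hy))
      (hgL _ (him y hy))).trans h1⟩
  · rw [hL]
    refine Tendsto.congr' (f₁ := fun y : ℝ => Complex.log (t + y * I) -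
      ((k : ℂ) + 1) * Real.pi * I) ?_ ?_
    · filter_upwards [self_mem_nhdsWithin] with y hy
      rw [hgL _ (him y hy)]
    · exact ((continuousWithinAt_log_closedUpper ht').tendsto.comp hζ).sub_const _

lemma continuous_inv_Gamma : Continuous fun x : ℝ => (Real.Gamma x)⁻¹ := by
  have h : Continuous fun x : ℝ => ((Complex.Gamma x)⁻¹).re :=
    Complex.continuous_re.comp
      (Complex.differentiable_one_div_Gamma.continuous.comp Complex.continuous_ofReal)
  refine h.congr fun x => ?_
  rw [Complex.Gamma_ofReal, ← Complex.ofReal_inv, Complex.ofReal_re]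

lemma Gamma_pos_of_even {k : ℕ} (hk : Even k) {x : ℝ} (hneg : ∀ j < k, x + (j : ℝ) < 0)
    (hpos : 0 < x + k) : 0 < Real.Gamma x := by
  rw [Gamma_eq_neg_one_pow_mul_exp hneg hpos, hk.neg_one_pow, one_mul]
  exact Real.exp_pos _

lemma Gamma_neg_of_odd {k : ℕ} (hk : Odd k) {x : ℝ} (hneg : ∀ j < k, x + (j : ℝ) < 0)
    (hpos : 0 < x + k) : Real.Gamma x < 0 := by
  rw [Gamma_eq_neg_one_pow_mul_exp hneg hpos, hk.neg_one_pow, neg_one_mul, neg_lt_zero]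
  exact Real.exp_pos _

lemma tendsto_im_zero_of_lt_neg_Gamma {k : ℕ} (hk : Even k) {g : ℂ → ℂ}
    (hgim : ∀ z : ℂ, 0 < z.im → 0 < (g z).im)
    (hgL : ∀ z : ℂ, 0 < z.im → logGamma (g z) = Complex.log z - ((k : ℂ) + 1) * Real.pi * I)
    {t x : ℝ} (hneg : ∀ j < k, x + (j : ℝ) < 0) (hpos : 0 < x + k) (ht : t < -Real.Gamma x) :
    Tendsto (fun y : ℝ => (g (t + y * I)).im) (𝓝[>] 0) (𝓝 0) := by
  have hG := Gamma_pos_of_even hk hneg hpos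
  have ht0 : t < 0 := by linarith
  have hmem : (-t)⁻¹ ∈ Set.Icc (Real.Gamma (-k : ℝ))⁻¹ (Real.Gamma x)⁻¹ := by
    rw [Real.Gamma_neg_nat_eq_zero, inv_zero]
    exact ⟨inv_nonneg.2 (by linarith), inv_anti₀ hG (by linarith)⟩
  obtain ⟨u, ⟨hu1, hu2⟩, hu⟩ := intermediate_value_Icc (show (-k : ℝ) ≤ x by linarith)
    continuous_inv_Gamma.continuousOn hmem
  have hu' : Real.Gamma u = -t := inv_injective hu
  have hpos' : 0 < u + k := by
    rcases hu1.eq_or_lt with h | h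
    · rw [← h, Real.Gamma_neg_nat_eq_zero] at hu'
      linarith
    · linarith
  have hneg' : ∀ j < k, u + (j : ℝ) < 0 := fun j hj => by linarith [hneg j hj]
  refine tendsto_im_zero_of_Gamma_eq hgim hgL ht0.ne (ofReal_ne_neg_natCast hneg' hpos') ?_
  rw [logGamma_ofReal_eq hneg' hpos', hu', Real.log_neg_eq_log]
  have : Complex.log t = Real.log t + Real.pi * I := by
    apply Complex.ext
    · simp [Complex.log_re]
    · simp [Complex.log_im, Complex.arg_ofReal_of_neg ht0]
  rw [this]
  ring

lemma tendsto_im_zero_of_neg_Gamma_lt {k : ℕ} (hk : Even k) {g : ℂ → ℂ}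
    (hgim : ∀ z : ℂ, 0 < z.im → 0 < (g z).im)
    (hgL : ∀ z : ℂ, 0 < z.im → logGamma (g z) = Complex.log z - ((k : ℂ) + 1) * Real.pi * I)
    {t x : ℝ} (hneg : x + k < 0) (hpos : 0 < x + (k + 1)) (ht : -Real.Gamma x < t) :
    Tendsto (fun y : ℝ => (g (t + y * I)).im) (𝓝[>] 0) (𝓝 0) := by
  have hnegs : ∀ u : ℝ, u + k < 0 → ∀ j < k + 1, u + (j : ℝ) < 0 := fun u hu j hj => by
    have : (j : ℝ) ≤ k := by exact_mod_cast Nat.lt_succ_iff.1 hj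
    linarith
  have hG := Gamma_neg_of_odd hk.add_one (hnegs x hneg) (by push_cast; exact hpos)
  have ht0 : 0 < t := by linarith
  have hmem : (-t)⁻¹ ∈ Set.Icc (Real.Gamma x)⁻¹ (Real.Gamma (-k : ℝ))⁻¹ := by
    rw [Real.Gamma_neg_nat_eq_zero, inv_zero]
    exact ⟨(inv_le_inv_of_neg hG (by linarith)).2 (by linarith), inv_nonpos.2 (by linarith)⟩
  obtain ⟨u, ⟨hu1, hu2⟩, hu⟩ := intermediate_value_Icc (show x ≤ (-k : ℝ) by linarith)
    continuous_inv_Gamma.continuousOn hmem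
  have hu' : Real.Gamma u = -t := inv_injective hu
  have hneg' : u + k < 0 := by
    rcases hu2.eq_or_lt with h | h
    · rw [h, Real.Gamma_neg_nat_eq_zero] at hu'
      linarith
    · linarith
  have hpos' : 0 < u + (k + 1 : ℕ) := by push_cast; linarith
  refine tendsto_im_zero_of_Gamma_eq hgim hgL ht0.ne'
    (ofReal_ne_neg_natCast (hnegs u hneg') hpos') ?_
  rw [logGamma_ofReal_eq (hnegs u hneg') hpos', hu', Real.log_neg_eq_log,
    Complex.ofReal_log ht0.le]
  push_cast
  ring

lemma exists_norm_add_natCast_le_of_le_im {k : ℕ} (hk : Even k) {g : ℂ → ℂ}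
    (hg : DifferentiableOn ℂ g {z : ℂ | 0 < z.im}) (hgim : ∀ z : ℂ, 0 < z.im → 0 < (g z).im)
    (hgL : ∀ z : ℂ, 0 < z.im → logGamma (g z) = Complex.log z - ((k : ℂ) + 1) * Real.pi * I)
    {ε : ℝ} (hε : 0 < ε) :
    ∃ C : ℝ, ∀ z : ℂ, ε ≤ z.im → ‖g z + k‖ ≤ C / (1 + ‖z‖) := by
  obtain ⟨A, B, hA, hB, hAB⟩ := exists_norm_le_add_mul_abs_log k
  obtain ⟨C, R, hR, hC⟩ := exists_norm_add_natCast_le_div hk hg hgim hgL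
  set M := A + B * (|Real.log ε| + |Real.log R|) + k with hM
  have hM0 : 0 ≤ M := by positivity
  refine ⟨max (M * (1 + R)) (C * (1 + R⁻¹)), fun z hz => ?_⟩
  have hz0 : 0 < z.im := hε.trans_le hz
  have hzn : ε ≤ ‖z‖ := hz.trans (Complex.im_le_norm z)
  have hzn0 : 0 < ‖z‖ := hε.trans_le hzn
  rw [le_div_iff₀ (by positivity)]
  rcases le_or_gt ‖z‖ R with h | h
  · refine le_max_of_le_left ?_
    have h1 : ‖g z + k‖ ≤ M := by
      have h2 := hAB z (g z) hz0 (hgim z hz0) (hgL z hz0)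
      have h3 : |Real.log ‖z‖| ≤ |Real.log ε| + |Real.log R| := by
        have h4 := Real.log_le_log hε hzn
        have h5 := Real.log_le_log hzn0 h
        refine abs_le.2 ⟨?_, ?_⟩
        · linarith [neg_abs_le (Real.log ε), abs_nonneg (Real.log R)]
        · linarith [le_abs_self (Real.log R), abs_nonneg (Real.log ε)]
      have h6 : ‖g z + k‖ ≤ ‖g z‖ + k := by simpa using norm_add_le (g z) (k : ℂ)
      have h7 := mul_le_mul_of_nonneg_left h3 hB
      linarith
    exact mul_le_mul h1 (by linarith) (by positivity) hM0
  · refine le_max_of_le_right ?_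
    have h1 := hC z hz0 h
    have hC0 : 0 ≤ C := by
      have := (norm_nonneg _).trans h1
      rwa [le_div_iff₀ hzn0, zero_mul] at this
    calc ‖g z + k‖ * (1 + ‖z‖) ≤ C / ‖z‖ * (1 + ‖z‖) := by gcongr
      _ = C * (1 + ‖z‖⁻¹) := by field_simp; ring
      _ ≤ C * (1 + R⁻¹) := by gcongr

lemma exists_abs_im_le {k : ℕ} {g : ℂ → ℂ} (hgim : ∀ z : ℂ, 0 < z.im → 0 < (g z).im)
    (hgL : ∀ z : ℂ, 0 < z.im → logGamma (g z) = Complex.log z - ((k : ℂ) + 1) * Real.pi * I)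
    {R : ℝ} (hR : 0 ≤ R) :
    ∃ A B : ℝ, 0 ≤ A ∧ 0 ≤ B ∧ ∀ t : ℝ, |t| ≤ R → t ≠ 0 → ∀ y : ℝ, 0 < y → y ≤ 1 →
      |(g (t + y * I)).im| ≤ A + B * |Real.log t| := by
  obtain ⟨A, B, hA, hB, hAB⟩ := exists_norm_le_add_mul_abs_log k
  have hlogR : 0 ≤ Real.log (R + 1) := Real.log_nonneg (by linarith)
  refine ⟨A + B * Real.log (R + 1), B, by positivity, hB, fun t ht ht0 y hy hy1 => ?_⟩
  have him : 0 < (t + y * I : ℂ).im := by simpa using hy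
  have h1 := hAB _ _ him (hgim _ him) (hgL _ him)
  have h2 : |t| ≤ ‖(t + y * I : ℂ)‖ := by simpa using Complex.abs_re_le_norm (t + y * I : ℂ)
  have h3 : ‖(t + y * I : ℂ)‖ ≤ R + 1 := by
    refine (norm_add_le _ _).trans ?_
    rw [norm_mul, norm_I, mul_one, norm_real, norm_real, Real.norm_eq_abs, Real.norm_eq_abs,
      abs_of_pos hy]
    linarith
  have ht' : 0 < |t| := abs_pos.2 ht0
  have h4 := Real.log_le_log ht' h2
  have h5 := Real.log_le_log (ht'.trans_le h2) h3
  rw [Real.log_abs] at h4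
  have h6 : |Real.log ‖(t + y * I : ℂ)‖| ≤ Real.log (R + 1) + |Real.log t| := by
    refine abs_le.2 ⟨?_, ?_⟩
    · linarith [neg_abs_le (Real.log t)]
    · linarith [abs_nonneg (Real.log t)]
  have h7 := mul_le_mul_of_nonneg_left h6 hB
  have h8 := Complex.abs_im_le_norm (g (t + y * I))
  linarith

open MeasureTheory in
lemma integrableOn_add_mul_abs_log (A B R : ℝ) :
    IntegrableOn (fun t : ℝ => A + B * |Real.log t|) (Set.Icc (-R) R) := by
  rcases le_or_gt (-R) R with h | h
  · rw [← intervalIntegrable_iff_integrableOn_Icc_of_le h]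
    exact intervalIntegrable_const.add
      ((intervalIntegral.intervalIntegrable_log' (a := -R) (b := R)).abs.const_mul B)
  · rw [Set.Icc_eq_empty (by linarith)]
    exact integrableOn_empty

lemma continuous_im_comp_add_mul_I {g : ℂ → ℂ} (hg : DifferentiableOn ℂ g {z : ℂ | 0 < z.im})
    {y : ℝ} (hy : 0 < y) : Continuous fun t : ℝ => (g (t + y * I)).im :=
  Complex.continuous_im.comp
    (hg.continuousOn.comp_continuous (by fun_prop) fun t => by simpa using hy)

open MeasureTheory in
lemma integrableOn_of_tendsto_im {k : ℕ} {g : ℂ → ℂ}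
    (hg : DifferentiableOn ℂ g {z : ℂ | 0 < z.im}) (hgim : ∀ z : ℂ, 0 < z.im → 0 < (g z).im)
    (hgL : ∀ z : ℂ, 0 < z.im → logGamma (g z) = Complex.log z - ((k : ℂ) + 1) * Real.pi * I)
    {R : ℝ} (hR : 0 ≤ R) {φ : ℝ → ℝ} {s : Set ℝ} (hs : MeasurableSet s)
    (hsR : s ⊆ Set.Icc (-R) R)
    (hφ : ∀ t ∈ s \ {0}, Tendsto (fun y : ℝ => (g (t + y * I)).im) (𝓝[>] 0) (𝓝 (φ t))) :
    IntegrableOn φ s := by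
  obtain ⟨A, B, hA, hB, hAB⟩ := exists_abs_im_le hgim hgL hR
  have hne : ∀ᵐ t : ℝ ∂volume.restrict s, t ∈ s \ {0} := by
    filter_upwards [ae_restrict_mem hs, ae_restrict_of_ae (Measure.ae_ne volume (0 : ℝ))]
      with t h1 h2
    exact ⟨h1, h2⟩
  refine Integrable.mono' ((integrableOn_add_mul_abs_log A B R).mono_set hsR) ?_ ?_
  · have hu : Tendsto (fun n : ℕ => 1 / ((n : ℝ) + 1)) atTop (𝓝[>] 0) :=
      tendsto_nhdsWithin_iff.2 ⟨tendsto_one_div_add_atTop_nhds_zero_nat,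
        Eventually.of_forall fun n => Set.mem_Ioi.2 Nat.one_div_pos_of_nat⟩
    refine aestronglyMeasurable_of_tendsto_ae atTop
      (f := fun (n : ℕ) (t : ℝ) => (g (t + (1 / ((n : ℝ) + 1) : ℝ) * I)).im)
      (fun n => (continuous_im_comp_add_mul_I hg Nat.one_div_pos_of_nat).aestronglyMeasurable) ?_
    filter_upwards [hne] with t ht
    exact (hφ t ht).comp hu
  · filter_upwards [hne] with t ht
    refine le_of_tendsto (hφ t ht).norm ?_
    filter_upwards [self_mem_nhdsWithin, Ioc_mem_nhdsGT one_pos] with y hy hy1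
    exact hAB t (abs_le.2 (hsR ht.1)) ht.2 y hy hy1.2

open MeasureTheory in
lemma exists_integrable_bound {k : ℕ} (hk : Even k) {g : ℂ → ℂ}
    (hg : DifferentiableOn ℂ g {z : ℂ | 0 < z.im}) (hgim : ∀ z : ℂ, 0 < z.im → 0 < (g z).im)
    (hgL : ∀ z : ℂ, 0 < z.im → logGamma (g z) = Complex.log z - ((k : ℂ) + 1) * Real.pi * I)
    {z : ℂ} (hz : 0 < z.im) :
    ∃ G : ℝ → ℝ, Integrable G ∧ ∀ t : ℝ, t ≠ 0 → ∀ y : ℝ, 0 < y → y ≤ 1 →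
      ‖((g (t + y * I)).im : ℂ) / ((t : ℂ) - z)‖ ≤ G t := by
  obtain ⟨C, R, hR, hC⟩ := exists_norm_add_natCast_le_div hk hg hgim hgL
  obtain ⟨A, B, hA, hB, hAB⟩ := exists_abs_im_le hgim hgL hR.le
  have him : ∀ t : ℝ, z.im ≤ ‖(t : ℂ) - z‖ := fun t => by
    simpa [abs_of_pos hz] using Complex.abs_im_le_norm ((t : ℂ) - z)
  set K := (1 + ‖z‖) / z.im + 1 with hK
  have hK0 : 0 < K := by positivity
  set C' := max C 0 * (1 + R⁻¹) * K with hC'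
  have hC0 : 0 ≤ C' := mul_nonneg (mul_nonneg (le_max_right _ _) (by positivity)) hK0.le
  refine ⟨fun t => (Set.Icc (-R) R).indicator (fun t => A + B * |Real.log t|) t * z.im⁻¹ +
    C' * (1 + t ^ 2)⁻¹, ?_, fun t ht y hy hy1 => ?_⟩
  · exact (((integrableOn_add_mul_abs_log A B R).integrable_indicator
      measurableSet_Icc).mul_const _).add (integrable_inv_one_add_sq.const_mul _)
  have hpos : 0 < ‖(t : ℂ) - z‖ := hz.trans_le (him t)
  rw [norm_div, norm_real, Real.norm_eq_abs]
  beta_reduce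
  rcases le_or_gt |t| R with h | h
  · rw [Set.indicator_of_mem (show t ∈ Set.Icc (-R) R from abs_le.1 h), div_eq_mul_inv]
    have h1 : |(g (t + y * I)).im| * ‖(t : ℂ) - z‖⁻¹ ≤ (A + B * |Real.log t|) * z.im⁻¹ :=
      mul_le_mul (hAB t h ht y hy hy1) (inv_anti₀ hz (him t)) (by positivity) (by positivity)
    have h2 : 0 ≤ C' * (1 + t ^ 2)⁻¹ := by positivity
    linarith
  · have hnot : t ∉ Set.Icc (-R) R := fun hmem => h.not_ge (abs_le.2 hmem)
    rw [Set.indicator_of_notMem hnot, zero_mul, zero_add]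
    have ht' : 0 < |t| := abs_pos.2 ht
    have him' : 0 < (t + y * I : ℂ).im := by simpa using hy
    have h2 : |t| ≤ ‖(t + y * I : ℂ)‖ := by simpa using Complex.abs_re_le_norm (t + y * I : ℂ)
    have h3 : |(g (t + y * I)).im| ≤ max C 0 / |t| := by
      have h4 := Complex.abs_im_le_norm (g (t + y * I) + k)
      rw [add_im, natCast_im, add_zero] at h4
      refine h4.trans ((hC _ him' (h.trans_le h2)).trans ?_)
      have : 0 ≤ max C 0 := le_max_right _ _
      gcongr
      exact le_max_left _ _
    have h5 : 1 + |t| ≤ K * ‖(t : ℂ) - z‖ := by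
      simpa using one_add_norm_le_mul_norm_sub hz (him t)
    have h6 := one_add_sq_le_one_add_abs_sq t
    have h7 : 1 + |t| ≤ (1 + R⁻¹) * |t| := by
      have : 1 ≤ R⁻¹ * |t| := by
        rw [inv_mul_eq_div, one_le_div₀ hR]
        exact h.le
      linarith
    rw [div_le_iff₀ hpos]
    refine h3.trans ?_
    rw [div_le_iff₀ ht']
    calc max C 0 = max C 0 * ((1 + t ^ 2)⁻¹ * (1 + t ^ 2)) := by field_simp
      _ ≤ max C 0 * ((1 + t ^ 2)⁻¹ * (((1 + R⁻¹) * |t|) * (K * ‖(t : ℂ) - z‖))) := by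
        refine mul_le_mul_of_nonneg_left (mul_le_mul_of_nonneg_left (h6.trans ?_)
          (by positivity)) (le_max_right _ _)
        rw [sq]
        gcongr
      _ = _ := by rw [hC']; ring

open MeasureTheory in
lemma integral_boundary_im_div_sub {k : ℕ} (hk : Even k) {g : ℂ → ℂ}
    (hg : DifferentiableOn ℂ g {z : ℂ | 0 < z.im}) (hgim : ∀ z : ℂ, 0 < z.im → 0 < (g z).im)
    (hgL : ∀ z : ℂ, 0 < z.im → logGamma (g z) = Complex.log z - ((k : ℂ) + 1) * Real.pi * I)
    {φ : ℝ → ℝ}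
    (hφ : ∀ t : ℝ, t ≠ 0 → Tendsto (fun y : ℝ => (g (t + y * I)).im) (𝓝[>] 0) (𝓝 (φ t)))
    {z : ℂ} (hz : 0 < z.im) :
    ∫ t : ℝ, (φ t : ℂ) / ((t : ℂ) - z) = Real.pi * (g z + k) := by
  obtain ⟨G, hG, hGb⟩ := exists_integrable_bound hk hg hgim hgL hz
  have hne : ∀ t : ℝ, (t : ℂ) - z ≠ 0 := fun t h => hz.ne' (by simpa using congrArg Complex.im h)
  have hlim := tendsto_integral_filter_of_dominated_convergence (μ := volume) (l := 𝓝[>] (0 : ℝ))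
    (F := fun (y : ℝ) (t : ℝ) => ((g (t + y * I)).im : ℂ) / ((t : ℂ) - z))
    (f := fun t : ℝ => (φ t : ℂ) / ((t : ℂ) - z)) G ?_ ?_ hG ?_
  · refine tendsto_nhds_unique hlim ?_
    have hopen : IsOpen {z : ℂ | 0 < z.im} := isOpen_lt continuous_const Complex.continuous_im
    have hcont : Tendsto (fun y : ℝ => (Real.pi * (g (z + y * I) + k) : ℂ)) (𝓝[>] 0)
        (𝓝 (Real.pi * (g z + k))) := by
      have h1 : Tendsto (fun y : ℝ => (z + y * I : ℂ)) (𝓝[>] 0) (𝓝 z) := by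
        have : Continuous fun y : ℝ => (z + y * I : ℂ) := by fun_prop
        simpa using (this.tendsto 0).mono_left nhdsWithin_le_nhds
      have h2 : ContinuousAt g z := (hg.differentiableAt (hopen.mem_nhds hz)).continuousAt
      exact ((h2.tendsto.comp h1).add_const _).const_mul _
    refine hcont.congr' ?_
    filter_upwards [self_mem_nhdsWithin] with y hy
    obtain ⟨C, hC⟩ := exists_norm_add_natCast_le_of_le_im hk hg hgim hgL hy
    have hdiff : DifferentiableOn ℂ (fun w : ℂ => g (w + y * I) + k) {w : ℂ | -y < w.im} := by
      refine (hg.comp (by fun_prop) fun w hw => ?_).add_const _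
      simp only [Set.mem_ofPred_eq, add_im, mul_im, ofReal_re, I_im, mul_one, ofReal_im, I_re,
        mul_zero, add_zero] at hw ⊢
      linarith
    have hmain := integral_im_div_sub hy hdiff (C := C) (fun w hw => ?_) hz
    · rw [← hmain]
      simp
    · have hwim : (w + y * I).im = w.im + y := by simp
      have hC0 : 0 ≤ C := by
        have := (norm_nonneg _).trans (hC (y * I) (by simp))
        rwa [le_div_iff₀ (by positivity), zero_mul] at this
      refine (hC _ (by rw [hwim]; linarith)).trans ?_
      have hnorm : ‖w‖ ≤ ‖w + y * I‖ := by
        rw [Complex.norm_eq_sqrt_sq_add_sq, Complex.norm_eq_sqrt_sq_add_sq, hwim]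
        refine Real.sqrt_le_sqrt ?_
        have hre : (w + y * I).re = w.re := by simp
        rw [hre]
        nlinarith [Set.mem_Ioi.1 hy]
      gcongr
  · filter_upwards [self_mem_nhdsWithin] with y hy
    exact ((Complex.continuous_ofReal.comp (continuous_im_comp_add_mul_I hg hy)).div
      (by fun_prop) hne).aestronglyMeasurable
  · filter_upwards [self_mem_nhdsWithin, Ioc_mem_nhdsGT one_pos] with y hy hy1
    filter_upwards [Measure.ae_ne volume (0 : ℝ)] with t ht
    exact hGb t ht y hy hy1.2
  · filter_upwards [Measure.ae_ne volume (0 : ℝ)] with t ht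
    exact ((Complex.continuous_ofReal.tendsto _).comp (hφ t ht)).div_const _

/-- Let `k ≥ 0` be even and `d_k(t) = (1/π)·lim_{y→0⁺} Im g_k(t+iy)` on
`I_k ∖ {0}` where `I_k = [−Γ(x_k), −Γ(x_{k+1})]`.  Then `d_k` is Lebesgue integrable on
`I_k` and for `z ∈ ℂ₊`, `g_k(z) = ∫_{−Γ(x_k)}^{−Γ(x_{k+1})} d_k(t)/(t − z) dt − k`. -/
theorem gk_integral_representation_even (x : ℕ → ℝ)
    (hx0 : x 0 ∈ Set.Ioi (0 : ℝ) ∧ deriv Real.Gamma (x 0) = 0)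
    (hxk : ∀ j : ℕ, 1 ≤ j → x j ∈ Set.Ioo (-(j : ℝ)) (-(j : ℝ) + 1) ∧
      deriv Real.Gamma (x j) = 0)
    (k : ℕ) (hkeven : Even k) (g : ℂ → ℂ)
    (hg : DifferentiableOn ℂ g {z : ℂ | 0 < z.im})
    (hgim : ∀ z : ℂ, 0 < z.im → 0 < (g z).im)
    (hgL : ∀ z : ℂ, 0 < z.im →
      logGamma (g z) = Complex.log z - ((k : ℂ) + 1) * Real.pi * I)
    (d : ℝ → ℝ)
    (hd : ∀ t ∈ Set.Icc (-Real.Gamma (x k)) (-Real.Gamma (x (k + 1))) \ {0},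
      Tendsto (fun y : ℝ => (1 / Real.pi) * (g ((t : ℂ) + y * I)).im)
        (nhdsWithin 0 (Set.Ioi 0)) (nhds (d t))) :
    MeasureTheory.IntegrableOn d
      (Set.Icc (-Real.Gamma (x k)) (-Real.Gamma (x (k + 1)))) ∧
    ∀ z : ℂ, 0 < z.im →
      g z = (∫ t in (-Real.Gamma (x k))..(-Real.Gamma (x (k + 1))),
        (d t : ℂ) / ((t : ℂ) - z)) - (k : ℂ) := by
  set a := -Real.Gamma (x k) with ha
  set b := -Real.Gamma (x (k + 1)) with hb
  have hk0 : (∀ j < k, x k + (j : ℝ) < 0) ∧ 0 < x k + k := by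
    rcases Nat.eq_zero_or_pos k with rfl | hkpos
    · exact ⟨fun j hj => absurd hj (Nat.not_lt_zero j), by simpa using hx0.1⟩
    · have h := (hxk k hkpos).1
      refine ⟨fun j hj => ?_, by linarith [h.1]⟩
      have : (j : ℝ) + 1 ≤ k := by exact_mod_cast hj
      linarith [h.2]
  have hk1 : x (k + 1) + k < 0 ∧ 0 < x (k + 1) + (k + 1) := by
    have h := (hxk (k + 1) (Nat.le_add_left 1 k)).1
    push_cast at h
    exact ⟨by linarith [h.2], by linarith [h.1]⟩
  have ha0 : a < 0 := neg_lt_zero.2 (Gamma_pos_of_even hkeven hk0.1 hk0.2)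
  have hb0 : 0 < b := by
    refine neg_pos.2 (Gamma_neg_of_odd hkeven.add_one (fun j hj => ?_) (by push_cast; exact hk1.2))
    have : (j : ℝ) ≤ k := by exact_mod_cast Nat.lt_succ_iff.1 hj
    linarith [hk1.1]
  have hpi : (Real.pi : ℂ) ≠ 0 := by exact_mod_cast Real.pi_ne_zero
  have hin : ∀ t ∈ Set.Icc a b \ {0},
      Tendsto (fun y : ℝ => (g (t + y * I)).im) (𝓝[>] 0) (𝓝 (Real.pi * d t)) := by
    intro t ht
    refine ((hd t ht).const_mul Real.pi).congr fun y => ?_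
    rw [← mul_assoc, mul_one_div_cancel Real.pi_ne_zero, one_mul]
  constructor
  · have hint := integrableOn_of_tendsto_im hg hgim hgL (R := max (-a) b)
      (hb0.le.trans (le_max_right _ _)) (measurableSet_Icc (a := a) (b := b))
      (Set.Icc_subset_Icc (by linarith [le_max_left (-a) b]) (le_max_right _ _)) hin
    refine (hint.const_mul Real.pi⁻¹).congr (Eventually.of_forall fun t => ?_)
    exact inv_mul_cancel_left₀ Real.pi_ne_zero _
  · intro z hz
    have hmain := integral_boundary_im_div_sub hkeven hg hgim hgL
      (φ := (Set.Icc a b).indicator fun t => Real.pi * d t) (fun t ht => ?_) hz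
    · have hind : ∀ t : ℝ, (((Set.Icc a b).indicator (fun t => Real.pi * d t) t : ℝ) : ℂ) /
          ((t : ℂ) - z) = (Set.Icc a b).indicator
            (fun t : ℝ => Real.pi * ((d t : ℂ) / ((t : ℂ) - z))) t := by
        intro t
        by_cases ht : t ∈ Set.Icc a b
        · rw [Set.indicator_of_mem ht, Set.indicator_of_mem ht]
          push_cast
          ring
        · rw [Set.indicator_of_notMem ht, Set.indicator_of_notMem ht]
          simp
      simp_rw [hind] at hmain
      rw [MeasureTheory.integral_indicator measurableSet_Icc,
        MeasureTheory.integral_const_mul] at hmain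
      rw [intervalIntegral.integral_of_le (by linarith),
        ← MeasureTheory.integral_Icc_eq_integral_Ioc, mul_left_cancel₀ hpi hmain]
      ring
    · by_cases htab : t ∈ Set.Icc a b
      · rw [Set.indicator_of_mem htab]
        exact hin t ⟨htab, ht⟩
      · rw [Set.indicator_of_notMem htab]
        rcases lt_or_ge t a with h | h
        · exact tendsto_im_zero_of_lt_neg_Gamma hkeven hgim hgL hk0.1 hk0.2 h
        · exact tendsto_im_zero_of_neg_Gamma_lt hkeven hgim hgL hk1.1 hk1.2
            (lt_of_not_ge fun hle => htab ⟨h, hle⟩)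
end

section
/- Let r ≥ 1 and suppose there exist 0 < α < β such that f is strictly decreasing on (α, β) and strictly increasing on (β, ∞) (so f has a local minimum at β). Then: (a) log f maps [β, ∞) strictly increasingly onto [log f(β), ∞); (b) for y > 0, both y ↦ Re(log f(β + iy)) and y ↦ Im(log f(β + iy)) are strictly decreasing and tend to −∞ as y → ∞; (c) log f maps {z : Re z > β, Im z > 0} bijectively onto Ω = Ω₁ ∪ Ω₂, where Ω₁ = { w : Re w ≥ log f(β), Im w > 0 } and Ω₂ = { w : ∃ y > 0 with Re w = Re(log f(β+iy)) and Im w > Im(log f(β+iy)) }. -/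
open Complex Filter

/-- The entire genus-2 function
`f(z) = z^r e^{az²+bz} ∏_k (1 + z/λ_k) e^{−z/λ_k + z²/(2λ_k²)}`. -/
noncomputable def genus2fun (r : ℕ) (a b : ℝ) (lam : ℕ → ℝ) (z : ℂ) : ℂ :=
  z ^ r * Complex.exp ((a : ℂ) * z ^ 2 + (b : ℂ) * z) *
    ∏' k : ℕ, ((1 + z / (lam k : ℂ)) *
      Complex.exp (-z / (lam k : ℂ) + z ^ 2 / (2 * (lam k : ℂ) ^ 2)))

/-- The holomorphic branch of `log f` on `ℂ ∖ (−∞,0]`: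
`log f(z) = r·Log z + az² + bz + ∑_k (Log(1 + z/λ_k) − z/λ_k + z²/(2λ_k²))`. -/
noncomputable def genus2log (r : ℕ) (a b : ℝ) (lam : ℕ → ℝ) (z : ℂ) : ℂ :=
  (r : ℂ) * Complex.log z + (a : ℂ) * z ^ 2 + (b : ℂ) * z +
    ∑' k : ℕ, (Complex.log (1 + z / (lam k : ℂ)) - z / (lam k : ℂ) +
      z ^ 2 / (2 * (lam k : ℂ) ^ 2))


/-- The termwise derivative of `genus2log`. -/
noncomputable def genus2logDeriv (r : ℕ) (a b : ℝ) (lam : ℕ → ℝ) (z : ℂ) : ℂ :=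
  (r : ℂ) / z + 2 * (a : ℂ) * z + (b : ℂ) +
    ∑' k : ℕ, (1 / (z + (lam k : ℂ)) - 1 / (lam k : ℂ) + z / (lam k : ℂ) ^ 2)

/-- The value at `x` of the second derivative of `genus2log`. -/
noncomputable def genus2logDeriv2 (r : ℕ) (a : ℝ) (lam : ℕ → ℝ) (x : ℝ) : ℝ :=
  2 * a - r / x ^ 2 + ∑' k : ℕ, (1 / lam k ^ 2 - 1 / (x + lam k) ^ 2)

section Series

variable {r : ℕ} {a b : ℝ} {lam : ℕ → ℝ}

theorem add_ofReal_ne_zero {z : ℂ} {l : ℝ} (h : 0 < z.re + l) : z + (l : ℂ) ≠ 0 := by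
  intro h0
  have := congrArg Complex.re h0
  simp at this
  linarith

theorem hasDerivAt_genus2log_term {l : ℝ} (hl : 0 < l) {z : ℂ} (h : 0 < z.re + l) :
    HasDerivAt (fun z : ℂ => Complex.log (1 + z / (l : ℂ)) - z / (l : ℂ) +
      z ^ 2 / (2 * (l : ℂ) ^ 2)) (1 / (z + (l : ℂ)) - 1 / (l : ℂ) + z / (l : ℂ) ^ 2) z := by
  have hl0 : (l : ℂ) ≠ 0 := by exact_mod_cast hl.ne'
  have hz := add_ofReal_ne_zero h
  have hslit : 1 + z / (l : ℂ) ∈ Complex.slitPlane := by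
    left
    rw [Complex.add_re, Complex.one_re, Complex.div_ofReal_re]
    have : 1 + z.re / l = (z.re + l) / l := by field_simp; ring
    rw [this]
    positivity
  have hne := Complex.slitPlane_ne_zero hslit
  have h1 : HasDerivAt (fun z : ℂ => z / (l : ℂ)) (1 / (l : ℂ)) z :=
    (hasDerivAt_id z).div_const _
  have h2 := (h1.const_add 1).clog hslit
  have h3 : HasDerivAt (fun z : ℂ => z ^ 2 / (2 * (l : ℂ) ^ 2)) (2 * z / (2 * (l : ℂ) ^ 2)) z := by
    simpa using ((hasDerivAt_id z).pow 2).div_const (2 * (l : ℂ) ^ 2)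
  refine ((h2.sub h1).add h3).congr_deriv ?_
  have : 1 + z / (l : ℂ) = (z + l) / l := by field_simp; ring
  rw [this]
  field_simp

theorem norm_genus2logDeriv_term_le {l R : ℝ} (hl : 0 < l) {z : ℂ} (h : -(l / 2) ≤ z.re)
    (hR : ‖z‖ ≤ R) :
    ‖1 / (z + (l : ℂ)) - 1 / (l : ℂ) + z / (l : ℂ) ^ 2‖ ≤ 2 * R ^ 2 * (1 / l ^ 3) := by
  have hl0 : (l : ℂ) ≠ 0 := by exact_mod_cast hl.ne'
  have hz := add_ofReal_ne_zero (z := z) (l := l) (by linarith)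
  have heq : 1 / (z + (l : ℂ)) - 1 / (l : ℂ) + z / (l : ℂ) ^ 2 =
      z ^ 2 / ((l : ℂ) ^ 2 * (z + l)) := by
    field_simp
    ring
  have hlow : l / 2 ≤ ‖z + (l : ℂ)‖ := by
    refine le_trans ?_ (Complex.re_le_norm _)
    simp
    linarith
  rw [heq, norm_div, norm_mul, norm_pow, norm_pow, Complex.norm_real, Real.norm_of_nonneg hl.le]
  calc ‖z‖ ^ 2 / (l ^ 2 * ‖z + (l : ℂ)‖) ≤ R ^ 2 / (l ^ 2 * (l / 2)) := by gcongr
    _ = 2 * R ^ 2 * (1 / l ^ 3) := by field_simp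

theorem hasDerivAt_genus2log_tsum (hpos : ∀ k, 0 < lam k) (hmono : Monotone lam)
    (hsum : Summable (fun k => 1 / lam k ^ 3)) {z : ℂ} (hz : 0 < z.re) :
    Summable (fun k => Complex.log (1 + z / (lam k : ℂ)) - z / (lam k : ℂ) +
      z ^ 2 / (2 * (lam k : ℂ) ^ 2)) ∧
    HasDerivAt (fun z : ℂ => ∑' k : ℕ, (Complex.log (1 + z / (lam k : ℂ)) - z / (lam k : ℂ) +
      z ^ 2 / (2 * (lam k : ℂ) ^ 2)))
      (∑' k : ℕ, (1 / (z + (lam k : ℂ)) - 1 / (lam k : ℂ) + z / (lam k : ℂ) ^ 2)) z := by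
  set t : Set ℂ := {w | -(lam 0 / 2) < w.re} ∩ Metric.ball 0 (‖z‖ + 1) with ht
  have hopen : IsOpen t :=
    (isOpen_lt continuous_const Complex.continuous_re).inter Metric.isOpen_ball
  have hconn : IsPreconnected t :=
    ((convex_halfSpace_re_gt _).inter (convex_ball _ _)).isPreconnected
  have hre : ∀ n, ∀ y ∈ t, -(lam n / 2) < y.re := fun n y hy => by
    have := hmono (Nat.zero_le n)
    have := hy.1
    simp only [Set.mem_ofPred_eq] at this
    linarith
  have hg : ∀ n, ∀ y ∈ t, HasDerivAt (fun z : ℂ => Complex.log (1 + z / (lam n : ℂ)) -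
      z / (lam n : ℂ) + z ^ 2 / (2 * (lam n : ℂ) ^ 2))
      (1 / (y + (lam n : ℂ)) - 1 / (lam n : ℂ) + y / (lam n : ℂ) ^ 2) y := fun n y hy =>
    hasDerivAt_genus2log_term (hpos n) (by linarith [hre n y hy, hpos n])
  have hg' : ∀ n, ∀ y ∈ t, ‖1 / (y + (lam n : ℂ)) - 1 / (lam n : ℂ) + y / (lam n : ℂ) ^ 2‖ ≤
      2 * (‖z‖ + 1) ^ 2 * (1 / lam n ^ 3) := fun n y hy =>
    norm_genus2logDeriv_term_le (hpos n) (hre n y hy).le (mem_ball_zero_iff.1 hy.2).le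
  have h0 : (0 : ℂ) ∈ t := ⟨by simpa using hpos 0, by simp; positivity⟩
  have hzt : z ∈ t := ⟨by simp only [Set.mem_ofPred_eq]; linarith [hpos 0], by simp⟩
  have hs0 : Summable fun n => (Complex.log (1 + (0 : ℂ) / (lam n : ℂ)) -
      (0 : ℂ) / (lam n : ℂ) + (0 : ℂ) ^ 2 / (2 * (lam n : ℂ) ^ 2)) := by simp
  have hu := hsum.mul_left (2 * (‖z‖ + 1) ^ 2)
  exact ⟨summable_of_summable_hasDerivAt_of_isPreconnected
      (g := fun n z => Complex.log (1 + z / (lam n : ℂ)) -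
        z / (lam n : ℂ) + z ^ 2 / (2 * (lam n : ℂ) ^ 2))
      (g' := fun n y => 1 / (y + (lam n : ℂ)) - 1 / (lam n : ℂ) + y / (lam n : ℂ) ^ 2)
      hu hopen hconn hg hg' h0 hs0 hzt,
    hasDerivAt_tsum_of_isPreconnected
      (g := fun n z => Complex.log (1 + z / (lam n : ℂ)) -
        z / (lam n : ℂ) + z ^ 2 / (2 * (lam n : ℂ) ^ 2))
      (g' := fun n y => 1 / (y + (lam n : ℂ)) - 1 / (lam n : ℂ) + y / (lam n : ℂ) ^ 2)
      hu hopen hconn hg hg' h0 hs0 hzt⟩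

theorem hasDerivAt_genus2log (hpos : ∀ k, 0 < lam k) (hmono : Monotone lam)
    (hsum : Summable (fun k => 1 / lam k ^ 3)) {z : ℂ} (hz : 0 < z.re) :
    HasDerivAt (genus2log r a b lam) (genus2logDeriv r a b lam z) z := by
  have h1 := (Complex.hasDerivAt_log (Or.inl hz)).const_mul (r : ℂ)
  have h2 : HasDerivAt (fun z : ℂ => (a : ℂ) * z ^ 2) ((a : ℂ) * (2 * z)) z := by
    simpa using ((hasDerivAt_id z).pow 2).const_mul (a : ℂ)
  have h3 : HasDerivAt (fun z : ℂ => (b : ℂ) * z) (b : ℂ) z := by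
    simpa using (hasDerivAt_id z).const_mul (b : ℂ)
  refine (((h1.add h2).add h3).add
    (hasDerivAt_genus2log_tsum hpos hmono hsum hz).2).congr_deriv ?_
  rw [genus2logDeriv]
  ring

theorem exp_genus2log (hpos : ∀ k, 0 < lam k) (hmono : Monotone lam)
    (hsum : Summable (fun k => 1 / lam k ^ 3)) {z : ℂ} (hz : 0 < z.re) :
    Complex.exp (genus2log r a b lam z) = genus2fun r a b lam z := by
  have hz0 : z ≠ 0 := by
    rintro rfl
    simp at hz
  have hprod := (hasDerivAt_genus2log_tsum hpos hmono hsum hz).1.hasSum.cexp.tprod_eq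
  rw [genus2log, genus2fun, Complex.exp_add, ← hprod, add_assoc, Complex.exp_add,
    Complex.exp_nat_mul, Complex.exp_log hz0]
  congr 1
  refine tprod_congr fun k => ?_
  have hl0 : (lam k : ℂ) ≠ 0 := by exact_mod_cast (hpos k).ne'
  have hne : 1 + z / (lam k : ℂ) ≠ 0 := by
    have := add_ofReal_ne_zero (z := z) (l := lam k) (by linarith [hpos k])
    have h : 1 + z / (lam k : ℂ) = (z + lam k) / lam k := by field_simp; ring
    rw [h]
    exact div_ne_zero this hl0
  simp only [Function.comp_apply]
  rw [sub_add, Complex.exp_sub, Complex.exp_log hne, neg_div, neg_add_eq_sub, ← neg_sub,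
    Complex.exp_neg, div_inv_eq_mul]

theorem genus2log_ofReal_im (hpos : ∀ k, 0 < lam k) {x : ℝ} (hx : 0 < x) :
    (genus2log r a b lam (x : ℂ)).im = 0 := by
  have h : genus2log r a b lam (x : ℂ) = ((r * Real.log x + a * x ^ 2 + b * x +
      ∑' k, (Real.log (1 + x / lam k) - x / lam k + x ^ 2 / (2 * lam k ^ 2)) : ℝ) : ℂ) := by
    rw [genus2log]
    push_cast
    rw [Complex.ofReal_log hx.le]
    congr 1
    refine tsum_congr fun k => ?_
    have := hpos k
    rw [Complex.ofReal_log (by positivity)]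
    push_cast
    rfl
  rw [h, Complex.ofReal_im]

theorem genus2fun_ofReal_re (hpos : ∀ k, 0 < lam k) (hmono : Monotone lam)
    (hsum : Summable (fun k => 1 / lam k ^ 3)) {x : ℝ} (hx : 0 < x) :
    (genus2fun r a b lam (x : ℂ)).re = Real.exp (genus2log r a b lam (x : ℂ)).re := by
  rw [← exp_genus2log hpos hmono hsum (by simpa using hx), Complex.exp_re,
    genus2log_ofReal_im hpos hx]
  simp

theorem summable_genus2logDeriv_term (hpos : ∀ k, 0 < lam k)
    (hsum : Summable (fun k => 1 / lam k ^ 3)) {z : ℂ} (hz : 0 < z.re) :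
    Summable fun k : ℕ => (1 / (z + (lam k : ℂ)) - 1 / (lam k : ℂ) + z / (lam k : ℂ) ^ 2) :=
  Summable.of_norm_bounded (hsum.mul_left (2 * ‖z‖ ^ 2)) fun k =>
    norm_genus2logDeriv_term_le (hpos k) (by linarith [hpos k]) le_rfl

theorem summable_genus2logDeriv2_term (hpos : ∀ k, 0 < lam k)
    (hsum : Summable (fun k => 1 / lam k ^ 3)) {x : ℝ} (hx : 0 < x) :
    Summable fun k : ℕ => (1 / lam k ^ 2 - 1 / (x + lam k) ^ 2) := by
  refine Summable.of_nonneg_of_le (fun k => ?_) (fun k => ?_) (hsum.mul_left (2 * x))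
  · have := hpos k
    rw [sub_nonneg]
    gcongr
    linarith
  · have := hpos k
    have h : 2 * x * (1 / lam k ^ 3) - (1 / lam k ^ 2 - 1 / (x + lam k) ^ 2) =
        (2 * x * (x + lam k) ^ 2 - lam k * (x + lam k) ^ 2 + lam k ^ 3) /
          (lam k ^ 3 * (x + lam k) ^ 2) := by
      field_simp
      ring
    rw [← sub_nonneg, h]
    have : 0 ≤ 2 * x * (x + lam k) ^ 2 - lam k * (x + lam k) ^ 2 + lam k ^ 3 := by
      have : 2 * x * (x + lam k) ^ 2 - lam k * (x + lam k) ^ 2 + lam k ^ 3 =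
        x * (2 * x ^ 2 + 3 * x * lam k) := by ring
      rw [this]
      positivity
    positivity

theorem genus2logDeriv_term_im (l : ℝ) (z : ℂ) :
    (1 / (z + (l : ℂ)) - 1 / (l : ℂ) + z / (l : ℂ) ^ 2).im =
      z.im * (1 / l ^ 2 - 1 / ((z.re + l) ^ 2 + z.im ^ 2)) := by
  rw [← Complex.ofReal_pow, ← Complex.ofReal_one, ← Complex.ofReal_div, Complex.add_im,
    Complex.sub_im, Complex.ofReal_im, Complex.div_ofReal_im, Complex.ofReal_one, one_div,
    Complex.inv_im, Complex.normSq_apply]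
  simp only [Complex.add_im, Complex.add_re, Complex.ofReal_im, Complex.ofReal_re]
  ring

theorem genus2logDeriv_term_re (l : ℝ) (z : ℂ) :
    (1 / (z + (l : ℂ)) - 1 / (l : ℂ) + z / (l : ℂ) ^ 2).re =
      (z.re + l) / ((z.re + l) ^ 2 + z.im ^ 2) - 1 / l + z.re / l ^ 2 := by
  rw [← Complex.ofReal_pow, ← Complex.ofReal_one, ← Complex.ofReal_div, Complex.add_re,
    Complex.sub_re, Complex.ofReal_re, Complex.div_ofReal_re, Complex.ofReal_one, one_div,
    Complex.inv_re, Complex.normSq_apply]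
  simp only [Complex.add_im, Complex.add_re, Complex.ofReal_im, Complex.ofReal_re]
  ring

theorem genus2logDeriv_im (hpos : ∀ k, 0 < lam k)
    (hsum : Summable (fun k => 1 / lam k ^ 3)) {z : ℂ} (hz : 0 < z.re) :
    Summable (fun k => z.im * (1 / lam k ^ 2 - 1 / ((z.re + lam k) ^ 2 + z.im ^ 2))) ∧
    (genus2logDeriv r a b lam z).im = z.im * (2 * a - r / (z.re ^ 2 + z.im ^ 2)) +
      ∑' k, z.im * (1 / lam k ^ 2 - 1 / ((z.re + lam k) ^ 2 + z.im ^ 2)) := by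
  have h := Complex.hasSum_im (summable_genus2logDeriv_term hpos hsum hz).hasSum
  simp only [genus2logDeriv_term_im] at h
  refine ⟨h.summable, ?_⟩
  rw [h.tsum_eq, genus2logDeriv, Complex.add_im]
  congr 1
  simp [Complex.div_im, Complex.normSq_apply]
  ring

theorem genus2logDeriv_re (hpos : ∀ k, 0 < lam k)
    (hsum : Summable (fun k => 1 / lam k ^ 3)) {z : ℂ} (hz : 0 < z.re) :
    Summable (fun k => (z.re + lam k) / ((z.re + lam k) ^ 2 + z.im ^ 2) - 1 / lam k +
      z.re / lam k ^ 2) ∧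
    (genus2logDeriv r a b lam z).re = r * z.re / (z.re ^ 2 + z.im ^ 2) + 2 * a * z.re + b +
      ∑' k, ((z.re + lam k) / ((z.re + lam k) ^ 2 + z.im ^ 2) - 1 / lam k +
        z.re / lam k ^ 2) := by
  have h := Complex.hasSum_re (summable_genus2logDeriv_term hpos hsum hz).hasSum
  simp only [genus2logDeriv_term_re] at h
  refine ⟨h.summable, ?_⟩
  rw [h.tsum_eq, genus2logDeriv, Complex.add_re]
  congr 1
  simp [Complex.div_re, Complex.normSq_apply]
  ring

/-- The imaginary part of the derivative grows at least linearly in `Im z`. -/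
theorem le_genus2logDeriv_im (hpos : ∀ k, 0 < lam k)
    (hsum : Summable (fun k => 1 / lam k ^ 3)) {β : ℝ} (hβ : 0 < β) {z : ℂ} (hz : β ≤ z.re)
    (hy : 0 ≤ z.im) :
    genus2logDeriv2 r a lam β * z.im ≤ (genus2logDeriv r a b lam z).im := by
  obtain ⟨hs, heq⟩ := genus2logDeriv_im (r := r) (a := a) (b := b) hpos hsum (hβ.trans_le hz)
  have hs2 := (summable_genus2logDeriv2_term hpos hsum hβ).mul_left z.im
  rw [heq, genus2logDeriv2, mul_comm, mul_add, ← tsum_mul_left]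
  refine add_le_add ?_ (hs2.tsum_le_tsum (fun k => ?_) hs)
  · gcongr
    nlinarith
  · have := hpos k
    gcongr
    nlinarith

/-- Convexity of the derivative on the positive axis, in the form of a tangent line estimate. -/
theorem genus2logDeriv_ofReal_re_ge (hpos : ∀ k, 0 < lam k)
    (hsum : Summable (fun k => 1 / lam k ^ 3)) {β x : ℝ} (hβ : 0 < β) (hx : 0 < x) :
    (genus2logDeriv r a b lam (β : ℂ)).re + genus2logDeriv2 r a lam β * (x - β) +
      r * (x - β) ^ 2 / (x * β ^ 2) ≤ (genus2logDeriv r a b lam (x : ℂ)).re := by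
  obtain ⟨hs, heq⟩ := genus2logDeriv_re (r := r) (a := a) (b := b) hpos hsum
    (z := (x : ℂ)) (by simpa using hx)
  obtain ⟨hs', heq'⟩ := genus2logDeriv_re (r := r) (a := a) (b := b) hpos hsum
    (z := (β : ℂ)) (by simpa using hβ)
  have hs2 := (summable_genus2logDeriv2_term hpos hsum hβ).mul_right (x - β)
  simp only [Complex.ofReal_re, Complex.ofReal_im] at hs heq hs' heq'
  rw [heq, heq', genus2logDeriv2]
  have key := (hs'.add hs2).tsum_le_tsum (fun k => ?_) hs
  · rw [hs'.tsum_add hs2, tsum_mul_right] at key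
    have : r * x / (x ^ 2 + 0 ^ 2) - r * β / (β ^ 2 + 0 ^ 2) + r / β ^ 2 * (x - β) =
        r * (x - β) ^ 2 / (x * β ^ 2) := by
      field_simp
      ring
    linarith
  · have := hpos k
    have h : (x + lam k) / ((x + lam k) ^ 2 + 0 ^ 2) - 1 / lam k + x / lam k ^ 2 -
        ((β + lam k) / ((β + lam k) ^ 2 + 0 ^ 2) - 1 / lam k + β / lam k ^ 2 +
        (1 / lam k ^ 2 - 1 / (β + lam k) ^ 2) * (x - β)) =
        (x - β) ^ 2 / ((x + lam k) * (β + lam k) ^ 2) := by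
      field_simp
      ring
    rw [← sub_nonneg, h]
    positivity

/-- The real part of the derivative decreases away from the real axis. -/
theorem genus2logDeriv_vertical_re_le (hpos : ∀ k, 0 < lam k)
    (hsum : Summable (fun k => 1 / lam k ^ 3)) {β : ℝ} (hβ : 0 < β) (y : ℝ) :
    (genus2logDeriv r a b lam ((β : ℂ) + y * I)).re ≤
      (genus2logDeriv r a b lam (β : ℂ)).re - r * y ^ 2 / (β * (β ^ 2 + y ^ 2)) := by
  obtain ⟨hs, heq⟩ := genus2logDeriv_re (r := r) (a := a) (b := b) hpos hsum
    (z := (β : ℂ) + y * I) (by simpa using hβ)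
  obtain ⟨hs', heq'⟩ := genus2logDeriv_re (r := r) (a := a) (b := b) hpos hsum
    (z := (β : ℂ)) (by simpa using hβ)
  have hre : ((β : ℂ) + y * I).re = β := by simp
  have him : ((β : ℂ) + y * I).im = y := by simp
  simp only [hre, him, Complex.ofReal_re, Complex.ofReal_im] at hs heq hs' heq'
  rw [heq, heq']
  have key := hs.tsum_le_tsum (fun k => ?_) hs'
  · have : r * β / (β ^ 2 + 0 ^ 2) - r * β / (β ^ 2 + y ^ 2) =
        r * y ^ 2 / (β * (β ^ 2 + y ^ 2)) := by
      field_simp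
      ring
    linarith
  · have := hpos k
    gcongr _ / (_ + ?_) - _ + _
    nlinarith [sq_nonneg y]

end Series

section Quadrant

variable {F D : ℂ → ℂ} {β c δ : ℝ}

theorem tendsto_atTop_of_deriv_ge {h h' : ℝ → ℝ} {t₀ m : ℝ} (hm : 0 < m)
    (hd : ∀ t, t₀ ≤ t → HasDerivAt h (h' t) t) (hge : ∀ t, t₀ ≤ t → m ≤ h' t) :
    Tendsto h atTop atTop := by
  have key := (convex_Ici t₀).mul_sub_le_image_sub_of_le_deriv (f := h) (C := m)
    (fun t ht => (hd t ht).continuousAt.continuousWithinAt)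
    (fun t ht => (hd t (interior_subset ht)).differentiableAt.differentiableWithinAt)
    (fun t ht => (hd t (interior_subset ht)).deriv ▸ hge t (interior_subset ht))
  have hlin : Tendsto (fun t => m * (t - t₀) + h t₀) atTop atTop :=
    tendsto_atTop_add_const_right _ _
      ((tendsto_atTop_add_const_right _ (-t₀) tendsto_id).const_mul_atTop hm)
  refine tendsto_atTop_mono' _ ?_ hlin
  filter_upwards [eventually_ge_atTop t₀] with t ht
  linarith [key t₀ Set.self_mem_Ici t ht ht]

theorem hasDerivAt_comp_line {z d : ℂ} {t : ℝ} (h : HasDerivAt F (D (z + t * d)) (z + t * d)) :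
    HasDerivAt (fun t : ℝ => F (z + t * d)) (D (z + t * d) * d) t := by
  have h1 : HasDerivAt (fun s : ℂ => z + s * d) d (t : ℂ) := by
    simpa using ((hasDerivAt_id (t : ℂ)).mul_const d).const_add z
  exact (h.comp (t : ℂ) h1).comp_ofReal

theorem HasDerivAt.complex_re {g : ℝ → ℂ} {g' : ℂ} {t : ℝ} (h : HasDerivAt g g' t) :
    HasDerivAt (fun t => (g t).re) g'.re t :=
  Complex.reCLM.hasFDerivAt.comp_hasDerivAt t h

theorem HasDerivAt.complex_im {g : ℝ → ℂ} {g' : ℂ} {t : ℝ} (h : HasDerivAt g g' t) :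
    HasDerivAt (fun t => (g t).im) g'.im t :=
  Complex.imCLM.hasFDerivAt.comp_hasDerivAt t h

/-- If `Im F' ≥ c Im` on a closed quadrant, then `F` is expanding there. -/
theorem le_norm_sub_of_le_deriv_im (hβ : 0 < β)
    (hF : ∀ z : ℂ, 0 < z.re → HasDerivAt F (D z) z)
    (hIm : ∀ z : ℂ, β ≤ z.re → 0 ≤ z.im → c * z.im ≤ (D z).im)
    {z w : ℂ} (hz : β ≤ z.re ∧ 0 ≤ z.im) (hw : β ≤ w.re ∧ 0 ≤ w.im) :
    c * (z.im + w.im) / 2 * ‖w - z‖ ≤ ‖F w - F z‖ := by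
  rcases eq_or_ne w z with rfl | hne
  · simp
  set d := w - z with hd
  have hd0 : 0 < ‖d‖ := norm_pos_iff.2 (sub_ne_zero.2 hne)
  have hQ : ∀ t ∈ Set.Icc (0 : ℝ) 1, β ≤ (z + t * d).re ∧ 0 ≤ (z + t * d).im := by
    rintro t ⟨h0, h1⟩
    have h1' : 0 ≤ 1 - t := by linarith
    have hre : (z + t * d).re = (1 - t) * z.re + t * w.re := by simp [hd]; ring
    have him : (z + t * d).im = (1 - t) * z.im + t * w.im := by simp [hd]; ring
    rw [hre, him]
    exact ⟨by nlinarith [mul_le_mul_of_nonneg_left hz.1 h1', mul_le_mul_of_nonneg_left hw.1 h0],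
      add_nonneg (mul_nonneg h1' hz.2) (mul_nonneg h0 hw.2)⟩
  set h : ℝ → ℝ := fun t => (F (z + t * d) * (starRingEnd ℂ) d).im -
    ‖d‖ ^ 2 * c * (t * z.im + t ^ 2 / 2 * d.im) with hh
  have hder : ∀ t ∈ Set.Icc (0 : ℝ) 1, HasDerivAt h
      (‖d‖ ^ 2 * ((D (z + t * d)).im - c * (z + t * d).im)) t := by
    intro t ht
    have h1 := ((hasDerivAt_comp_line (hF _ (hβ.trans_le (hQ t ht).1))).mul_const
      ((starRingEnd ℂ) d)).complex_im
    have h2 : HasDerivAt (fun t : ℝ => ‖d‖ ^ 2 * c * (t * z.im + t ^ 2 / 2 * d.im))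
        (‖d‖ ^ 2 * c * (z.im + t * d.im)) t := by
      have h3 : HasDerivAt (fun t : ℝ => t ^ 2 / 2 * d.im) (t * d.im) t := by
        refine ((((hasDerivAt_id t).pow 2).div_const 2).mul_const d.im).congr_deriv ?_
        simp
      have h4 : HasDerivAt (fun t : ℝ => t * z.im) z.im t := by
        simpa using (hasDerivAt_id t).mul_const z.im
      exact (h4.add h3).const_mul _
    refine (h1.sub h2).congr_deriv ?_
    have : D (z + t * d) * d * (starRingEnd ℂ) d = D (z + t * d) * ((‖d‖ ^ 2 : ℝ) : ℂ) := by
      rw [mul_assoc, Complex.mul_conj, Complex.normSq_eq_norm_sq]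
    rw [this, Complex.im_mul_ofReal]
    simp
    ring
  have hmono : MonotoneOn h (Set.Icc 0 1) := by
    refine monotoneOn_of_deriv_nonneg (convex_Icc 0 1)
      (fun t ht => (hder t ht).continuousAt.continuousWithinAt)
      (fun t ht => (hder t (interior_subset ht)).differentiableAt.differentiableWithinAt)
      (fun t ht => ?_)
    have ht' := interior_subset ht
    rw [(hder t ht').deriv]
    have := hIm _ (hQ t ht').1 (hQ t ht').2
    exact mul_nonneg (sq_nonneg _) (by linarith)
  have h01 := hmono (Set.left_mem_Icc.2 zero_le_one) (Set.right_mem_Icc.2 zero_le_one) zero_le_one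
  have hzd : z + d = w := by simp [hd]
  have hdim : d.im = w.im - z.im := by simp [hd]
  simp only [hh, Complex.ofReal_zero, zero_mul, add_zero, Complex.ofReal_one, one_mul, hzd,
    hdim] at h01
  have h2 : ‖d‖ ^ 2 * (c * (z.im + w.im) / 2) ≤ ((F w - F z) * (starRingEnd ℂ) d).im := by
    rw [sub_mul, Complex.sub_im]
    nlinarith
  have h3 : ((F w - F z) * (starRingEnd ℂ) d).im ≤ ‖F w - F z‖ * ‖d‖ := by
    refine (Complex.im_le_norm _).trans ?_
    rw [norm_mul, RCLike.norm_conj]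
  refine le_of_mul_le_mul_right ?_ hd0
  linarith

theorem convex_quadrant (β : ℝ) : Convex ℝ {z : ℂ | β < z.re ∧ 0 < z.im} :=
  (convex_halfSpace_re_gt β).inter (convex_halfSpace_im_gt 0)

theorem isOpen_quadrant (β : ℝ) : IsOpen {z : ℂ | β < z.re ∧ 0 < z.im} :=
  (isOpen_lt continuous_const Complex.continuous_re).inter
    (isOpen_lt continuous_const Complex.continuous_im)

theorem isOpen_image_quadrant (hβ : 0 < β) (hc : 0 < c)
    (hF : ∀ z : ℂ, 0 < z.re → HasDerivAt F (D z) z)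
    (hIm : ∀ z : ℂ, β ≤ z.re → 0 ≤ z.im → c * z.im ≤ (D z).im) :
    IsOpen (F '' {z : ℂ | β < z.re ∧ 0 < z.im}) := by
  have han : AnalyticOnNhd ℂ F {z : ℂ | β < z.re ∧ 0 < z.im} :=
    DifferentiableOn.analyticOnNhd
      (fun z hz => (hF z (hβ.trans hz.1)).differentiableAt.differentiableWithinAt)
      (isOpen_quadrant β)
  rcases han.is_constant_or_isOpen (convex_quadrant β).isPreconnected with ⟨w, hw⟩ | h
  · exfalso
    have hz : β < (⟨β + 1, 1⟩ : ℂ).re ∧ 0 < (⟨β + 1, 1⟩ : ℂ).im := by simp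
    have heq : F =ᶠ[nhds ⟨β + 1, 1⟩] fun _ => w :=
      Filter.eventually_of_mem ((isOpen_quadrant β).mem_nhds hz) hw
    have h0 := (hF ⟨β + 1, 1⟩ (hβ.trans hz.1)).unique
      ((hasDerivAt_const (⟨β + 1, 1⟩ : ℂ) w).congr_of_eventuallyEq heq)
    have := hIm ⟨β + 1, 1⟩ hz.1.le hz.2.le
    rw [h0] at this
    simp at this
    linarith
  · exact h _ subset_rfl (isOpen_quadrant β)

/-- On the closed quadrant `F` is proper, so limits of values on the open quadrant are values on
the closed one. -/
theorem closure_image_quadrant_subset (hβ : 0 < β) (hc : 0 < c)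
    (hF : ∀ z : ℂ, 0 < z.re → HasDerivAt F (D z) z)
    (hIm : ∀ z : ℂ, β ≤ z.re → 0 ≤ z.im → c * z.im ≤ (D z).im) :
    closure (F '' {z : ℂ | β < z.re ∧ 0 < z.im}) ⊆ F '' {z : ℂ | β ≤ z.re ∧ 0 ≤ z.im} := by
  intro w hw
  set z₀ : ℂ := ⟨β, 1⟩ with hz₀
  set R : ℝ := (‖w - F z₀‖ + 1) / (c / 2) with hR
  set K : Set ℂ := {z : ℂ | β ≤ z.re ∧ 0 ≤ z.im} ∩ Metric.closedBall z₀ R with hK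
  have hclosed : IsClosed {z : ℂ | β ≤ z.re ∧ 0 ≤ z.im} :=
    (isClosed_le continuous_const Complex.continuous_re).inter
      (isClosed_le continuous_const Complex.continuous_im)
  have hKc : IsCompact K := (isCompact_closedBall z₀ R).inter_left hclosed
  have himg : IsClosed (F '' K) := (hKc.image_of_continuousOn fun z hz =>
    (hF z (hβ.trans_le hz.1.1)).continuousAt.continuousWithinAt).isClosed
  have hmem : w ∈ closure (F '' K) := by
    rw [Metric.mem_closure_iff] at hw ⊢
    intro ε hε
    obtain ⟨_, ⟨z, hz, rfl⟩, hdist⟩ := hw (min ε 1) (lt_min hε one_pos)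
    refine ⟨F z, ⟨z, ⟨⟨hz.1.le, hz.2.le⟩, ?_⟩, rfl⟩, hdist.trans_le (min_le_left _ _)⟩
    have hexp := le_norm_sub_of_le_deriv_im hβ hF hIm (z := z₀) (w := z)
      ⟨by simp [hz₀], by simp [hz₀]⟩ ⟨hz.1.le, hz.2.le⟩
    have h1 : c / 2 * ‖z - z₀‖ ≤ ‖F z - F z₀‖ := by
      refine le_trans ?_ hexp
      have : z₀.im = 1 := rfl
      rw [this]
      gcongr
      nlinarith [hz.2]
    have h2 : ‖F z - F z₀‖ ≤ ‖w - F z₀‖ + 1 := by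
      have h3 : ‖F z - w‖ ≤ 1 := by
        rw [← dist_eq_norm, dist_comm]
        exact (hdist.trans_le (min_le_right _ _)).le
      calc ‖F z - F z₀‖ = ‖(w - F z₀) + (F z - w)‖ := by congr 1; ring
        _ ≤ _ := (norm_add_le _ _).trans (by linarith)
    rw [Metric.mem_closedBall, dist_eq_norm, hR, le_div_iff₀ (by positivity)]
    linarith
  rw [himg.closure_eq] at hmem
  exact Set.image_mono Set.inter_subset_left hmem

/-- A parametrization of the boundary of the quadrant `Re z > β`, `Im z > 0`. -/
noncomputable def quadrantBoundary (β s : ℝ) : ℂ := ⟨β + max s 0, max (-s) 0⟩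

theorem quadrantBoundary_of_nonneg {s : ℝ} (hs : 0 ≤ s) :
    quadrantBoundary β s = ((β + s : ℝ) : ℂ) := by
  apply Complex.ext <;> simp [quadrantBoundary, hs]

theorem quadrantBoundary_neg {y : ℝ} (hy : 0 ≤ y) :
    quadrantBoundary β (-y) = (β : ℂ) + y * I := by
  apply Complex.ext <;> simp [quadrantBoundary, hy]

theorem continuous_quadrantBoundary (β : ℝ) : Continuous (quadrantBoundary β) := by
  have : quadrantBoundary β =
      fun s : ℝ => ((β + max s 0 : ℝ) : ℂ) + ((max (-s) 0 : ℝ) : ℂ) * I := by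
    funext s
    apply Complex.ext <;> simp [quadrantBoundary]
  rw [this]
  fun_prop

/-- Mapping properties of a function on the quadrant `Re z > β`, `Im z > 0` that is real on the
real axis and whose derivative satisfies suitable sign conditions. -/
theorem quadrant_conformal_onto (hβ : 0 < β) (hc : 0 < c) (hδ : 0 < δ)
    (hF : ∀ z : ℂ, 0 < z.re → HasDerivAt F (D z) z)
    (hreal : ∀ x : ℝ, β ≤ x → (F x).im = 0)
    (hIm : ∀ z : ℂ, β ≤ z.re → 0 ≤ z.im → c * z.im ≤ (D z).im)
    (hRe : ∀ x : ℝ, β ≤ x → c * (x - β) ≤ (D x).re)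
    (hneg : ∀ y : ℝ, 0 < y → (D (β + y * I)).re < 0)
    (hneg' : ∀ y : ℝ, 1 ≤ y → (D (β + y * I)).re ≤ -δ) :
    (StrictMonoOn (fun x : ℝ => (F x).re) (Set.Ici β) ∧
      (fun x : ℝ => (F x).re) '' Set.Ici β = Set.Ici (F β).re) ∧
    (StrictAntiOn (fun y : ℝ => (F (β + y * I)).re) (Set.Ioi 0) ∧
      StrictAntiOn (fun y : ℝ => (F (β + y * I)).im) (Set.Ioi 0) ∧
      Tendsto (fun y : ℝ => (F (β + y * I)).re) atTop atBot ∧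
      Tendsto (fun y : ℝ => (F (β + y * I)).im) atTop atBot) ∧
    Set.BijOn F {z : ℂ | β < z.re ∧ 0 < z.im}
      ({w : ℂ | (F β).re ≤ w.re ∧ 0 < w.im} ∪
        {w : ℂ | ∃ y > (0 : ℝ), w.re = (F (β + y * I)).re ∧ (F (β + y * I)).im < w.im}) := by
  have hdx : ∀ x : ℝ, β ≤ x → HasDerivAt (fun x : ℝ => (F x).re) (D x).re x := fun x hx =>
    (hF x (by simpa using hβ.trans_le hx)).comp_ofReal.complex_re
  have hdv : ∀ (x y : ℝ), β ≤ x →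
      HasDerivAt (fun y : ℝ => F (x + y * I)) (D (x + y * I) * I) y := fun x y hx =>
    hasDerivAt_comp_line (hF _ (by simpa using hβ.trans_le hx))
  have hdre : ∀ y : ℝ,
      HasDerivAt (fun y : ℝ => (F (β + y * I)).re) (-(D (β + y * I)).im) y := fun y => by
    simpa using (hdv β y le_rfl).complex_re
  have hdim : ∀ y : ℝ,
      HasDerivAt (fun y : ℝ => (F (β + y * I)).im) (D (β + y * I)).re y := fun y => by
    simpa using (hdv β y le_rfl).complex_im
  have hIm' : ∀ y : ℝ, 0 ≤ y → c * y ≤ (D (β + y * I)).im := fun y hy => by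
    simpa using hIm (β + y * I) (by simp) (by simpa using hy)
  have hmono : StrictMonoOn (fun x : ℝ => (F x).re) (Set.Ici β) := by
    refine strictMonoOn_of_deriv_pos (convex_Ici β)
      (fun x hx => (hdx x hx).continuousAt.continuousWithinAt) fun x hx => ?_
    rw [interior_Ici, Set.mem_Ioi] at hx
    rw [(hdx x hx.le).deriv]
    exact (mul_pos hc (sub_pos.2 hx)).trans_le (hRe x hx.le)
  have htop : Tendsto (fun x : ℝ => (F x).re) atTop atTop :=
    tendsto_atTop_of_deriv_ge (t₀ := β + 1) hc (fun t ht => hdx t (by linarith))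
      fun t ht => by nlinarith [hRe t (by linarith)]
  have hanti : StrictAntiOn (fun y : ℝ => (F (β + y * I)).re) (Set.Ici 0) := by
    refine strictAntiOn_of_deriv_neg (convex_Ici 0)
      (fun y _ => (hdre y).continuousAt.continuousWithinAt) fun y hy => ?_
    rw [interior_Ici, Set.mem_Ioi] at hy
    rw [(hdre y).deriv]
    linarith [hIm' y hy.le, mul_pos hc hy]
  have hanti' : StrictAntiOn (fun y : ℝ => (F (β + y * I)).im) (Set.Ici 0) := by
    refine strictAntiOn_of_deriv_neg (convex_Ici 0)
      (fun y _ => (hdim y).continuousAt.continuousWithinAt) fun y hy => ?_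
    rw [interior_Ici, Set.mem_Ioi] at hy
    rw [(hdim y).deriv]
    exact hneg y hy
  have hbot : Tendsto (fun y : ℝ => (F (β + y * I)).re) atTop atBot := by
    rw [← tendsto_neg_atTop_iff]
    refine tendsto_atTop_of_deriv_ge (t₀ := 1) hc (fun t _ => (hdre t).neg) fun t ht => ?_
    nlinarith [hIm' t (by linarith)]
  have hbot' : Tendsto (fun y : ℝ => (F (β + y * I)).im) atTop atBot := by
    rw [← tendsto_neg_atTop_iff]
    refine tendsto_atTop_of_deriv_ge (t₀ := 1) hδ (fun t _ => (hdim t).neg) fun t ht => ?_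
    linarith [hneg' t ht]
  set γ := quadrantBoundary β with hγ
  have hγQ : ∀ s, β ≤ (γ s).re ∧ 0 ≤ (γ s).im := fun s => by
    simp [hγ, quadrantBoundary]
  have hγsurj : ∀ z : ℂ, β ≤ z.re → 0 ≤ z.im → ¬ (β < z.re ∧ 0 < z.im) → ∃ s, γ s = z := by
    intro z h1 h2 h3
    rcases h1.eq_or_lt with h | h
    · refine ⟨-z.im, ?_⟩
      rw [hγ, quadrantBoundary_neg h2, h, Complex.re_add_im]
    · have h0 : z.im = 0 := le_antisymm (not_lt.1 fun h' => h3 ⟨h, h'⟩) h2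
      refine ⟨z.re - β, ?_⟩
      rw [hγ, quadrantBoundary_of_nonneg (by linarith)]
      apply Complex.ext <;> simp [h0]
  have hFγ : Continuous fun s => F (γ s) := by
    refine continuous_iff_continuousAt.2 fun s => ?_
    exact (hF _ (hβ.trans_le (hγQ s).1)).continuousAt.comp
      (continuous_quadrantBoundary β).continuousAt
  set ρ : ℝ → ℝ := fun s => (F (γ s)).re with hρ
  have hρc : Continuous ρ := Complex.continuous_re.comp hFγ
  have hρnn : ∀ s, 0 ≤ s → ρ s = (F ((β + s : ℝ) : ℂ)).re := fun s hs => by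
    rw [hρ, hγ]
    simp only [quadrantBoundary_of_nonneg hs]
  have hρneg : ∀ y, 0 ≤ y → ρ (-y) = (F (β + y * I)).re := fun y hy => by
    rw [hρ, hγ]
    simp only [quadrantBoundary_neg hy]
  have hρmono : StrictMono ρ := by
    refine StrictMonoOn.Iic_union_Ici (a := 0) ?_ ?_
    · intro s hs t ht hst
      rw [Set.mem_Iic] at hs ht
      have := hanti (a := -t) (b := -s) (by simpa using ht) (by simpa using hs) (by linarith)
      rw [← neg_neg s, ← neg_neg t, hρneg _ (by linarith), hρneg _ (by linarith)]
      exact this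
    · intro s hs t ht hst
      rw [Set.mem_Ici] at hs ht
      rw [hρnn s hs, hρnn t ht]
      exact hmono (by simpa using hs) (by simpa using ht) (by linarith)
  have hρsurj : Function.Surjective ρ := by
    refine hρc.surjective ?_ ?_
    · refine (htop.comp (tendsto_atTop_add_const_left _ β tendsto_id)).congr' ?_
      filter_upwards [eventually_ge_atTop 0] with s hs
      rw [hρnn s hs]
      rfl
    · refine (hbot.comp tendsto_neg_atBot_atTop).congr' ?_
      filter_upwards [eventually_le_atBot 0] with s hs
      have := hρneg (-s) (by linarith)
      rw [neg_neg] at this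
      rw [this]
      rfl
  let e : ℝ ≃o ℝ := hρmono.orderIsoOfSurjective ρ hρsurj
  have he : ∀ s, e.symm (ρ s) = s := fun s => e.symm_apply_apply s
  have he' : ∀ u, ρ (e.symm u) = u := fun u => e.apply_symm_apply u
  set g : ℝ → ℝ := fun u => (F (γ (e.symm u))).im with hg
  have hgc : Continuous g :=
    (Complex.continuous_im.comp hFγ).comp e.symm.continuous
  have hgγ : ∀ s, g (F (γ s)).re = (F (γ s)).im := fun s => by
    have := he s
    simp only [hρ] at this
    simp only [hg, this]
  have hρ0 : ρ 0 = (F β).re := by simpa using hρnn 0 le_rfl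
  have hΩ : ({w : ℂ | (F β).re ≤ w.re ∧ 0 < w.im} ∪
      {w : ℂ | ∃ y > (0 : ℝ), w.re = (F (β + y * I)).re ∧ (F (β + y * I)).im < w.im}) =
      {w : ℂ | g w.re < w.im} := by
    ext w
    obtain ⟨s, hs⟩ := hρsurj w.re
    have hgs : g (ρ s) = (F (γ s)).im := hgγ s
    simp only [Set.mem_union, Set.mem_ofPred_eq, ← hs, hgs, ← hρ0, hρmono.le_iff_le]
    rcases le_or_gt 0 s with h0 | h0
    · have hz : (F (γ s)).im = 0 := by
        rw [hγ, quadrantBoundary_of_nonneg h0]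
        exact hreal _ (by linarith)
      rw [hz]
      refine ⟨?_, fun h => Or.inl ⟨h0, h⟩⟩
      rintro (h | ⟨y, hy, h1, h2⟩)
      · exact h.2
      · rw [← hρneg y hy.le, hρmono.injective.eq_iff] at h1
        linarith
    · have hys : γ s = β + ((-s : ℝ) : ℂ) * I := by
        rw [hγ, ← quadrantBoundary_neg (by linarith), neg_neg]
      constructor
      · rintro (h | ⟨y, hy, h1, h2⟩)
        · linarith [h.1]
        · rw [← hρneg y hy.le, hρmono.injective.eq_iff] at h1
          rw [hys, h1, neg_neg]
          exact h2
      · intro h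
        refine Or.inr ⟨-s, by linarith, ?_, ?_⟩
        · rw [← hρneg _ (by linarith), neg_neg]
        · rw [← hys]
          exact h
  have hgre : Continuous fun w : ℂ => g w.re := hgc.comp Complex.continuous_re
  have hΩopen : IsOpen {w : ℂ | g w.re < w.im} := isOpen_lt hgre Complex.continuous_im
  have hΩopen' : IsOpen {w : ℂ | w.im < g w.re} := isOpen_lt Complex.continuous_im hgre
  have hΩconn : IsPreconnected {w : ℂ | g w.re < w.im} := by
    have himg : {w : ℂ | g w.re < w.im} =
        (fun w : ℂ => w + (g w.re : ℂ) * I) '' {w : ℂ | 0 < w.im} := by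
      ext w
      constructor
      · intro h
        refine ⟨w - (g w.re : ℂ) * I, by simpa using h, by simp⟩
      · rintro ⟨v, hv, rfl⟩
        simpa using hv
    rw [himg]
    refine (convex_halfSpace_im_gt 0).isPreconnected.image _ (Continuous.continuousOn ?_)
    fun_prop
  set Q : Set ℂ := {z : ℂ | β < z.re ∧ 0 < z.im} with hQ
  have hFQconn : IsPreconnected (F '' Q) :=
    (convex_quadrant β).isPreconnected.image _ fun z hz =>
      (hF z (hβ.trans hz.1)).continuousAt.continuousWithinAt
  have hinj : ∀ z w : ℂ, β ≤ z.re ∧ 0 ≤ z.im → β < w.re ∧ 0 < w.im → F w = F z → w = z := by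
    intro z w hz hw h
    have hexp := le_norm_sub_of_le_deriv_im hβ hF hIm hz ⟨hw.1.le, hw.2.le⟩
    rw [h, sub_self, norm_zero] at hexp
    have hpos : 0 < c * (z.im + w.im) / 2 := by
      have := add_pos_of_nonneg_of_pos hz.2 hw.2
      positivity
    have : ‖w - z‖ ≤ 0 := nonpos_of_mul_nonpos_right hexp hpos
    exact sub_eq_zero.1 (norm_le_zero_iff.1 this)
  have hcompl : F '' Q ⊆ {w : ℂ | g w.re < w.im} ∪ {w : ℂ | w.im < g w.re} := by
    rintro _ ⟨z, hz, rfl⟩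
    rcases lt_trichotomy (g (F z).re) (F z).im with h | h | h
    · exact Or.inl h
    · exfalso
      have hz' : F z = F (γ (e.symm (F z).re)) := by
        apply Complex.ext
        · exact (he' (F z).re).symm
        · exact h.symm
      have := hinj _ z (hγQ _) hz hz'
      rw [this] at hz
      simp only [hQ, hγ, quadrantBoundary, Set.mem_ofPred_eq, lt_add_iff_pos_right, lt_max_iff,
        lt_irrefl, or_false] at hz
      linarith [hz.1, hz.2]
    · exact Or.inr h
  have hmeets : (F '' Q ∩ {w : ℂ | g w.re < w.im}).Nonempty := by
    have hx : β ≤ β + 1 := by linarith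
    have hd0 := hdv (β + 1 : ℝ) 0 hx
    have hdi : HasDerivAt (fun y : ℝ => (F ((β + 1 : ℝ) + y * I)).im) (D (β + 1 : ℝ)).re 0 := by
      simpa using hd0.complex_im
    have hsgn := eventually_nhdsWithin_sign_eq_of_deriv_pos (x₀ := 0)
      (by
        rw [hdi.deriv]
        exact (by nlinarith : 0 < c * (β + 1 - β)).trans_le (hRe _ hx))
      (by simpa using hreal _ hx)
    have hlim : ∀ᶠ y : ℝ in nhds 0, (F β).re < (F ((β + 1 : ℝ) + y * I)).re := by
      refine hd0.complex_re.continuousAt.eventually (lt_mem_nhds ?_)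
      simpa using hmono (a := β) (b := β + 1) (by simp) (by simp) (by linarith)
    obtain ⟨y, ⟨hy1, hy2⟩, hy0⟩ := (((hsgn.and hlim).filter_mono nhdsWithin_le_nhds).and
      (self_mem_nhdsWithin (s := Set.Ioi (0 : ℝ)))).exists
    rw [sub_zero, sign_pos hy0, sign_eq_one_iff] at hy1
    refine ⟨_, ⟨((β + 1 : ℝ) : ℂ) + y * I, ⟨by simp, by simpa using hy0⟩, rfl⟩, ?_⟩
    rw [← hΩ]
    exact Or.inl ⟨hy2.le, hy1⟩
  have hsub : F '' Q ⊆ {w : ℂ | g w.re < w.im} :=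
    hFQconn.subset_left_of_subset_union hΩopen hΩopen'
      (Set.disjoint_left.2 fun w (h1 : g w.re < w.im) (h2 : w.im < g w.re) => lt_asymm h1 h2)
      hcompl hmeets
  have hsup : {w : ℂ | g w.re < w.im} ⊆ F '' Q := by
    refine hΩconn.subset_of_closure_inter_subset (isOpen_image_quadrant hβ hc hF hIm)
      (by rwa [Set.inter_comm]) ?_
    rintro w ⟨hw, hwΩ⟩
    obtain ⟨z, hz, rfl⟩ := closure_image_quadrant_subset hβ hc hF hIm hw
    by_contra hcon
    obtain ⟨s, rfl⟩ := hγsurj z hz.1 hz.2 fun hzQ => hcon ⟨z, hzQ, rfl⟩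
    rw [Set.mem_ofPred_eq, hgγ] at hwΩ
    exact lt_irrefl _ hwΩ
  refine ⟨⟨hmono, ?_⟩, ⟨hanti.mono Set.Ioi_subset_Ici_self, hanti'.mono Set.Ioi_subset_Ici_self,
    hbot, hbot'⟩, ?_⟩
  · ext u
    constructor
    · rintro ⟨x, hx, rfl⟩
      exact hmono.monotoneOn Set.self_mem_Ici hx hx
    · intro hu
      obtain ⟨s, rfl⟩ := hρsurj u
      rw [Set.mem_Ici, ← hρ0, hρmono.le_iff_le] at hu
      exact ⟨β + s, by simpa using hu, (hρnn s hu).symm⟩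
  · rw [hΩ]
    exact ⟨fun z hz => hsub ⟨z, hz, rfl⟩,
      fun z hz w hw h => hinj w z ⟨hw.1.le, hw.2.le⟩ hz h, hsup⟩

end Quadrant

section Minimum

variable {r : ℕ} {a b : ℝ} {lam : ℕ → ℝ} {α β : ℝ}

/-- At a local minimum `β` of `f` the derivative of `log f` vanishes and the second derivative is
positive. -/
theorem genus2log_minimum (hr : 1 ≤ r) (hpos : ∀ k, 0 < lam k) (hmono : Monotone lam)
    (hsum : Summable (fun k => 1 / lam k ^ 3)) (hα : 0 < α) (hαβ : α < β)
    (hdec : StrictAntiOn (fun x : ℝ => (genus2fun r a b lam (x : ℂ)).re) (Set.Ioo α β))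
    (hinc : StrictMonoOn (fun x : ℝ => (genus2fun r a b lam (x : ℂ)).re) (Set.Ioi β)) :
    (genus2logDeriv r a b lam (β : ℂ)).re = 0 ∧ 0 < genus2logDeriv2 r a lam β := by
  have hβ : 0 < β := hα.trans hαβ
  set h : ℝ → ℝ := fun x => (genus2log r a b lam (x : ℂ)).re with hh
  have hd : ∀ x : ℝ, 0 < x → HasDerivAt h (genus2logDeriv r a b lam (x : ℂ)).re x := fun x hx =>
    (hasDerivAt_genus2log hpos hmono hsum (z := (x : ℂ)) (by simpa using hx)).comp_ofReal.complex_re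
  have hlt : ∀ x y : ℝ, 0 < x → 0 < y → (genus2fun r a b lam (x : ℂ)).re <
      (genus2fun r a b lam (y : ℂ)).re → h x < h y := fun x y hx hy hxy => by
    rwa [genus2fun_ofReal_re hpos hmono hsum hx, genus2fun_ofReal_re hpos hmono hsum hy,
      Real.exp_lt_exp] at hxy
  have hanti : StrictAntiOn h (Set.Ioo α β) := fun x hx y hy hxy =>
    hlt y x (hα.trans hy.1) (hα.trans hx.1) (hdec hx hy hxy)
  have hinc' : StrictMonoOn h (Set.Ioi β) := fun x hx y hy hxy =>
    hlt x y (hβ.trans hx) (hβ.trans hy) (hinc hx hy hxy)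
  have hcont := (hd β hβ).continuousAt
  have hmin : IsLocalMin h β := by
    filter_upwards [lt_mem_nhds hαβ] with x hx
    rcases lt_trichotomy x β with hxβ | rfl | hxβ
    · refine le_of_tendsto (hcont.tendsto.mono_left (nhdsWithin_le_nhds (s := Set.Iio β))) ?_
      filter_upwards [Ioo_mem_nhdsLT hxβ] with y hy
      exact (hanti ⟨hx, hxβ⟩ ⟨hx.trans hy.1, hy.2⟩ hy.1).le
    · exact le_rfl
    · refine le_of_tendsto (hcont.tendsto.mono_left (nhdsWithin_le_nhds (s := Set.Ioi β))) ?_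
      filter_upwards [Ioo_mem_nhdsGT hxβ] with y hy
      exact (hinc' hy.1 hxβ hy.2).le
  have hzero := hmin.hasDerivAt_eq_zero (hd β hβ)
  refine ⟨hzero, ?_⟩
  by_contra hcon
  have hmonoI : StrictMonoOn h (Set.Ioo α β) := by
    refine strictMonoOn_of_deriv_pos (convex_Ioo α β)
      (fun x hx => (hd x (hα.trans hx.1)).continuousAt.continuousWithinAt) fun x hx => ?_
    have hx := interior_subset hx
    have hx0 := hα.trans hx.1
    rw [(hd x hx0).deriv]
    refine lt_of_lt_of_le ?_ (genus2logDeriv_ofReal_re_ge hpos hsum hβ hx0)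
    have h1 : 0 < r * (x - β) ^ 2 / (x * β ^ 2) := by
      have : (0 : ℝ) < r := by exact_mod_cast hr
      have : 0 < (x - β) ^ 2 := by nlinarith [hx.2]
      positivity
    have h2 : 0 ≤ genus2logDeriv2 r a lam β * (x - β) :=
      mul_nonneg_of_nonpos_of_nonpos (not_lt.1 hcon) (by linarith [hx.2])
    rw [hzero]
    linarith
  have h1 : (2 * α + β) / 3 ∈ Set.Ioo α β := ⟨by linarith, by linarith⟩
  have h2 : (α + 2 * β) / 3 ∈ Set.Ioo α β := ⟨by linarith, by linarith⟩
  have h12 : (2 * α + β) / 3 < (α + 2 * β) / 3 := by linarith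
  exact lt_asymm (hanti h1 h2 h12) (hmonoI h1 h2 h12)

end Minimum

/-- Let `r ≥ 1` and suppose `f` decreases strictly on `(α,β)` and
increases strictly on `(β,∞)` for some `0 < α < β`.  Then (a) `log f` maps `[β,∞)`
strictly increasingly onto `[log f(β),∞)`; (b) for `y > 0` both
`y ↦ Re log f(β+iy)` and `y ↦ Im log f(β+iy)` strictly decrease and tend to `−∞`;
(c) `log f` maps `{Re z > β, Im z > 0}` bijectively onto `Ω = Ω₁ ∪ Ω₂`. -/
theorem genus2_conformal_onto (r : ℕ) (hr : 1 ≤ r) (a b : ℝ) (lam : ℕ → ℝ)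
    (hpos : ∀ k, 0 < lam k) (hmono : Monotone lam)
    (hdiv : ¬ Summable (fun k => 1 / lam k ^ 2))
    (hsum : Summable (fun k => 1 / lam k ^ 3))
    (α β : ℝ) (hα : 0 < α) (hαβ : α < β)
    (hdec : StrictAntiOn (fun x : ℝ => (genus2fun r a b lam (x : ℂ)).re) (Set.Ioo α β))
    (hinc : StrictMonoOn (fun x : ℝ => (genus2fun r a b lam (x : ℂ)).re) (Set.Ioi β)) :
    ((∀ x ∈ Set.Ici β, (genus2log r a b lam (x : ℂ)).im = 0) ∧
      StrictMonoOn (fun x : ℝ => (genus2log r a b lam (x : ℂ)).re) (Set.Ici β) ∧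
      (fun x : ℝ => (genus2log r a b lam (x : ℂ)).re) '' Set.Ici β =
        Set.Ici ((genus2log r a b lam (β : ℂ)).re)) ∧
    (StrictAntiOn (fun y : ℝ => (genus2log r a b lam ((β : ℂ) + y * I)).re)
        (Set.Ioi 0) ∧
      StrictAntiOn (fun y : ℝ => (genus2log r a b lam ((β : ℂ) + y * I)).im)
        (Set.Ioi 0) ∧
      Tendsto (fun y : ℝ => (genus2log r a b lam ((β : ℂ) + y * I)).re) atTop atBot ∧
      Tendsto (fun y : ℝ => (genus2log r a b lam ((β : ℂ) + y * I)).im) atTop atBot) ∧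
    Set.BijOn (genus2log r a b lam) {z : ℂ | β < z.re ∧ 0 < z.im}
      ({w : ℂ | (genus2log r a b lam (β : ℂ)).re ≤ w.re ∧ 0 < w.im} ∪
        {w : ℂ | ∃ y > (0 : ℝ),
          w.re = (genus2log r a b lam ((β : ℂ) + y * I)).re ∧
          (genus2log r a b lam ((β : ℂ) + y * I)).im < w.im}) := by
  have hβ : 0 < β := hα.trans hαβ
  obtain ⟨hzero, hc⟩ := genus2log_minimum hr hpos hmono hsum hα hαβ hdec hinc
  have hr0 : (0 : ℝ) < r := by exact_mod_cast hr
  have hreal : ∀ x : ℝ, β ≤ x → (genus2log r a b lam (x : ℂ)).im = 0 := fun x hx =>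
    genus2log_ofReal_im hpos (hβ.trans_le hx)
  have hvert := fun y : ℝ =>
    genus2logDeriv_vertical_re_le (r := r) (a := a) (b := b) hpos hsum hβ y
  have hδ : 0 < r / (β * (β ^ 2 + 1)) := by positivity
  have key := quadrant_conformal_onto (D := genus2logDeriv r a b lam) hβ hc hδ
    (fun z hz => hasDerivAt_genus2log hpos hmono hsum hz) hreal
    (fun z hz hy => le_genus2logDeriv_im hpos hsum hβ hz hy)
    (fun x hx => by
      have hx0 := hβ.trans_le hx
      have h1 := genus2logDeriv_ofReal_re_ge (r := r) (a := a) (b := b) hpos hsum hβ hx0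
      have h2 : 0 ≤ r * (x - β) ^ 2 / (x * β ^ 2) := by positivity
      linarith)
    (fun y hy => by
      have h1 : 0 < r * y ^ 2 / (β * (β ^ 2 + y ^ 2)) := by positivity
      linarith [hvert y])
    (fun y hy => by
      have h1 : r / (β * (β ^ 2 + 1)) ≤ r * y ^ 2 / (β * (β ^ 2 + y ^ 2)) := by
        rw [div_le_div_iff₀ (by positivity) (by positivity)]
        have h3 : (β ^ 2 + y ^ 2) ≤ y ^ 2 * (β ^ 2 + 1) := by
          nlinarith [mul_nonneg (sq_nonneg β) (by nlinarith : 0 ≤ y ^ 2 - 1)]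
        nlinarith [mul_le_mul_of_nonneg_left h3 (by positivity : 0 ≤ r * β)]
      linarith [hvert y])
  exact ⟨⟨hreal, key.1⟩, key.2⟩
end
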